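/- arXiv:math/9808018 — 6 statements merged into one kernel-verified Lean document; each statement's English description precedes it below -/
import Mathlib

section
/- For all nonnegative integers n and x, Z_{2n}(2x) = T_n(x) · R_n(x). -/
open Finset

/-- Binomial coefficient `C(m,k)` for `m : ℕ` and `k : ℤ`, zero if `k < 0` or `k > m`. -/
def C (m : ℕ) (k : ℤ) : ℚ := if 0 ≤ k then (m.choose k.toNat : ℚ) else 0

/-- `Z_m(y) = det(δ_ij + C(y+i+j, i))_{0 ≤ i,j ≤ m-1}`. -/
def Z (m y : ℕ) : ℚ :=
  Matrix.det (fun i j : Fin m =>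
    (if i = j then (1 : ℚ) else 0) + C (y + (i : ℕ) + (j : ℕ)) (i : ℤ))

/-- `T_n(x) = det(C(x+i+j, 2j-i))_{0 ≤ i,j ≤ n-1}`. -/
def T (n x : ℕ) : ℚ :=
  Matrix.det (fun i j : Fin n => C (x + (i : ℕ) + (j : ℕ)) (2 * (j : ℤ) - (i : ℤ)))

/-- `R_n(x) = det(C(x+i+j, 2i-j) + 2 C(x+i+j+2, 2i-j+1))_{0 ≤ i,j ≤ n-1}`. -/
def R (n x : ℕ) : ℚ :=
  Matrix.det (fun i j : Fin n =>
    C (x + (i : ℕ) + (j : ℕ)) (2 * (i : ℤ) - (j : ℤ)) +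
      2 * C (x + (i : ℕ) + (j : ℕ) + 2) (2 * (i : ℤ) - (j : ℤ) + 1))

/-- Binet's formula for the sequence `F (N + 2) = (α + β) F (N + 1) - α β F N`, with `F` expanded
in powers of `α + β` and `-α β`. -/
theorem sub_mul_sum_choose_mul_pow {A : Type*} [CommRing A] (α β : A) (N L : ℕ) (hL : N < 2 * L) :
    (α - β) * ∑ j ∈ range L, ((N - j).choose j : A) * (α + β) ^ (N - 2 * j) * (-(α * β)) ^ j =
      α ^ (N + 1) - β ^ (N + 1) := by
  induction N using Nat.twoStepInduction generalizing L with
  | zero =>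
    obtain ⟨L, rfl⟩ := Nat.exists_eq_add_of_lt (show 0 < L by omega)
    simp [sum_range_succ']
  | one =>
    obtain ⟨L, rfl⟩ := Nat.exists_eq_add_of_lt (show 0 < L by omega)
    simp only [zero_add, sum_range_succ']
    rw [sum_eq_zero fun j _ => by simp]
    simp
    ring
  | more N ih₀ ih₁ =>
    obtain ⟨L, rfl⟩ := Nat.exists_eq_add_of_lt (show 0 < L by omega)
    have h₀ := ih₀ (0 + L) (by omega)
    have h₁ := ih₁ (0 + L + 1) (by omega)
    have step : ∀ j, ((N + 2 - (j + 1)).choose (j + 1) : A) * (α + β) ^ (N + 2 - 2 * (j + 1)) *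
          (-(α * β)) ^ (j + 1) =
        (α + β) * (((N + 1 - (j + 1)).choose (j + 1) : A) * (α + β) ^ (N + 1 - 2 * (j + 1)) *
          (-(α * β)) ^ (j + 1)) +
        (-(α * β)) * (((N - j).choose j : A) * (α + β) ^ (N - 2 * j) * (-(α * β)) ^ j) := by
      intro j
      rw [show N + 1 - (j + 1) = N - j by omega, show N + 2 - 2 * (j + 1) = N - 2 * j by omega]
      rcases lt_or_ge N (2 * j + 1) with h | h
      · rw [Nat.choose_eq_zero_of_lt (show N - j < j + 1 by omega)]
        rcases lt_or_ge N j with h' | h'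
        · rw [Nat.choose_eq_zero_of_lt (show N - j < j by omega),
            Nat.choose_eq_zero_of_lt (show N + 2 - (j + 1) < j + 1 by omega)]
          simp
        · rw [show N + 2 - (j + 1) = N - j + 1 by omega, Nat.choose_succ_succ,
            Nat.choose_eq_zero_of_lt (show N - j < j + 1 by omega)]
          push_cast
          ring
      · rw [show N + 2 - (j + 1) = N - j + 1 by omega, Nat.choose_succ_succ,
          show N - 2 * j = N + 1 - 2 * (j + 1) + 1 by omega]
        push_cast
        ring
    rw [sum_range_succ'] at h₁ ⊢
    simp only [step, sum_add_distrib, ← mul_sum]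
    simp only [Nat.sub_zero, Nat.choose_zero_right, mul_zero, pow_zero] at h₁ ⊢
    linear_combination (α + β) * h₁ - α * β * h₀

theorem C_natCast (m k : ℕ) : C m k = m.choose k := by
  simp [C]

theorem C_of_neg (m : ℕ) {k : ℤ} (hk : k < 0) : C m k = 0 := by
  simp [C, hk]

theorem C_of_lt (m : ℕ) {k : ℤ} (hk : m < k) : C m k = 0 := by
  rw [C, if_pos (by omega), Nat.choose_eq_zero_of_lt (by omega), Nat.cast_zero]

theorem sum_C_smul_X_pow_mul_u_pow {A : Type*} [CommRing A] [Algebra ℚ A] {X u : A}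
    (hu : u * (1 - X) = 1) (p e L : ℕ) (hq : 0 < p + e) (hL : p + e ≤ L) :
    (2 - X) * ∑ i ∈ range L, C (p + i) (2 * i + 1 - e) • (X ^ (2 * i + 1) * u ^ (i + 1)) =
      X ^ e * (u ^ (p + e) - (-1) ^ (p + e) * (X - 1) ^ p) := by
  have hv : ∀ m, u ^ m * (1 - X) ^ m = 1 := fun m => by rw [← mul_pow, hu, one_pow]
  have hcut : ∑ i ∈ range L, C (p + i) (2 * i + 1 - e) • (X ^ (2 * i + 1) * u ^ (i + 1)) =
      ∑ i ∈ range (p + e), C (p + i) (2 * i + 1 - e) • (X ^ (2 * i + 1) * u ^ (i + 1)) := by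
    symm
    apply sum_subset (range_subset_range.2 hL)
    intro i _ hi
    rw [mem_range, not_lt] at hi
    rw [C_of_lt _ (by push_cast; omega), zero_smul]
  have binet := sub_mul_sum_choose_mul_pow 1 (X - 1) (2 * p + e - 1) (p + e) (by omega)
  have hterm : ∀ j ∈ range (p + e),
      C (p + (p + e - 1 - j)) (2 * ((p + e - 1 - j : ℕ) : ℤ) + 1 - e) •
        (X ^ (2 * (p + e - 1 - j) + 1) * u ^ (p + e - 1 - j + 1)) =
      X ^ e * u ^ (p + e) * (((2 * p + e - 1 - j).choose j : A) *
        (1 + (X - 1)) ^ (2 * p + e - 1 - 2 * j) * (-(1 * (X - 1))) ^ j) := by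
    intro j hj
    rw [mem_range] at hj
    rcases lt_or_ge (2 * p + e - 1) (2 * j) with h | h
    · rw [C_of_neg _ (by omega), Nat.choose_eq_zero_of_lt (by omega)]
      simp
    · rw [show 2 * ((p + e - 1 - j : ℕ) : ℤ) + 1 - e = ((2 * p + e - 1 - 2 * j : ℕ) : ℤ) by omega,
        C_natCast, show p + (p + e - 1 - j) = 2 * p + e - 1 - j by omega,
        ← Nat.choose_symm (show j ≤ 2 * p + e - 1 - j by omega),
        show 2 * p + e - 1 - j - j = 2 * p + e - 1 - 2 * j by omega,
        show 2 * (p + e - 1 - j) + 1 = e + (2 * p + e - 1 - 2 * j) by omega,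
        Algebra.smul_def, map_natCast]
      have : u ^ (p + e) = u ^ (p + e - 1 - j + 1) * u ^ j := by
        rw [← pow_add]; congr 1; omega
      rw [this, show 1 + (X - 1) = X by ring, show -(1 * (X - 1)) = 1 - X by ring, pow_add]
      linear_combination (-((2 * p + e - 1 - j).choose (2 * p + e - 1 - 2 * j) : A) * X ^ e *
        X ^ (2 * p + e - 1 - 2 * j) * u ^ (p + e - 1 - j + 1)) * hv j
  rw [hcut, ← sum_range_reflect, sum_congr rfl hterm, ← mul_sum]
  have hX : u ^ (p + e) * (X - 1) ^ (p + e) = (-1) ^ (p + e) := by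
    rw [← mul_pow]; congr 1; linear_combination -hu
  rw [show 2 * p + e - 1 + 1 = p + e + p by omega] at binet
  linear_combination X ^ e * u ^ (p + e) * binet - X ^ e * (X - 1) ^ p * hX

theorem sum_C_smul_mul_X_pow_even {A : Type*} [CommRing A] [IsDomain A] [Algebra ℚ A] {X u : A}
    (hX : X ≠ 0) (hu : u * (1 - X) = 1) (x k L : ℕ) (hL : x + 2 * k + 1 ≤ L) :
    ∑ i ∈ range L, C (x + i + k) (2 * i - k) • ((2 - X) * X ^ (2 * i) * u ^ (x + 1 + i)) =
      (X * (X - 1)) ^ k + u ^ (2 * x + 1) * (u * (u - 1)) ^ k := by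
  have key := sum_C_smul_X_pow_mul_u_pow hu (x + k) (k + 1) L (by omega) (by omega)
  have hx : u ^ x * ((-1) ^ x * (X - 1) ^ x) = 1 := by
    rw [← mul_pow, ← mul_pow, show u * (-1 * (X - 1)) = 1 by linear_combination hu, one_pow]
  have hs : ((-1 : A) ^ k) * (-1) ^ k = 1 := by rw [← mul_pow]; simp
  have hsum : X * ∑ i ∈ range L,
        C (x + i + k) (2 * i - k) • ((2 - X) * X ^ (2 * i) * u ^ (x + 1 + i)) =
      u ^ x * ((2 - X) * ∑ i ∈ range L,
        C (x + k + i) (2 * i + 1 - (k + 1 : ℕ)) • (X ^ (2 * i + 1) * u ^ (i + 1))) := by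
    simp only [mul_sum]
    refine sum_congr rfl fun i _ => ?_
    rw [show x + k + i = x + i + k by ring,
      show (2 * i + 1 - (k + 1 : ℕ) : ℤ) = 2 * i - k by push_cast; ring]
    simp only [Algebra.smul_def]
    ring
  apply mul_left_cancel₀ hX
  rw [hsum, key, show u - 1 = X * u by linear_combination hu]
  simp only [mul_pow, pow_add, pow_mul, pow_one]
  linear_combination (X ^ k * X * (X - 1) ^ k) * hx +
    (X ^ k * X * (X - 1) ^ k * u ^ x * (-1) ^ x * (X - 1) ^ x) * hs

theorem sum_C_add_two_mul_C_smul_X_pow_odd {A : Type*} [CommRing A] [IsDomain A] [Algebra ℚ A] {X u : A}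
    (hX : 2 - X ≠ 0) (hu : u * (1 - X) = 1) (x k L : ℕ) (hL : x + 2 * k + 2 ≤ L) :
    ∑ i ∈ range L, (C (x + i + k) (2 * i - k) + 2 * C (x + i + k + 2) (2 * i - k + 1)) •
        (X ^ (2 * i + 1) * u ^ (x + 1 + i)) =
      (2 * X - 1) * (X * (X - 1)) ^ k + u ^ (2 * x + 1) * ((2 * u - 1) * (u * (u - 1)) ^ k) := by
  have key₁ := sum_C_smul_X_pow_mul_u_pow hu (x + k) (k + 1) L (by omega) (by omega)
  have key₂ := sum_C_smul_X_pow_mul_u_pow hu (x + k + 2) k L (by omega) (by omega)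
  have hx : u ^ x * ((-1) ^ x * (X - 1) ^ x) = 1 := by
    rw [← mul_pow, ← mul_pow, show u * (-1 * (X - 1)) = 1 by linear_combination hu, one_pow]
  have hs : ((-1 : A) ^ k) * (-1) ^ k = 1 := by rw [← mul_pow]; simp
  have hsum : ∑ i ∈ range L,
        (C (x + i + k) (2 * i - k) + 2 * C (x + i + k + 2) (2 * i - k + 1)) •
          (X ^ (2 * i + 1) * u ^ (x + 1 + i)) =
      u ^ x * (∑ i ∈ range L,
        C (x + k + i) (2 * i + 1 - (k + 1 : ℕ)) • (X ^ (2 * i + 1) * u ^ (i + 1)) +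
        2 * ∑ i ∈ range L,
        C (x + k + 2 + i) (2 * i + 1 - k) • (X ^ (2 * i + 1) * u ^ (i + 1))) := by
    simp only [mul_add, mul_sum, ← sum_add_distrib]
    refine sum_congr rfl fun i _ => ?_
    rw [show x + k + i = x + i + k by ring, show x + k + 2 + i = x + i + k + 2 by ring,
      show (2 * i + 1 - (k + 1 : ℕ) : ℤ) = 2 * i - k by push_cast; ring,
      show (2 * i + 1 - k : ℤ) = 2 * i - k + 1 by ring]
    simp only [Algebra.smul_def, map_add, map_mul, map_ofNat]
    ring
  apply mul_left_cancel₀ hX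
  rw [hsum, mul_left_comm, mul_add, key₁, mul_left_comm, key₂]
  have hu₁ : u - 1 = X * u := by linear_combination hu
  rw [hu₁]
  simp only [mul_pow, pow_add, pow_mul, pow_one]
  linear_combination X ^ k * (X - 1) ^ k * (X - 2 * (X - 1) ^ 2) *
    (hx + u ^ x * ((-1) ^ x * (X - 1) ^ x) * hs) - 2 * u ^ (2 * x + 2 * k + 1) * X ^ k * hu

section Bases

open Polynomial in
/-- A basis of polynomials consisting of eigenvectors of `f(X) ↦ f(1 - X)`, listed by
parity `b` of the degree. -/
noncomputable def reflBasis (k b : ℕ) : ℚ[X] := (2 * X - 1) ^ b * (X * (X - 1)) ^ k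

theorem natDegree_reflBasis_le (k b : ℕ) : (reflBasis k b).natDegree ≤ b + 2 * k := by
  unfold reflBasis
  compute_degree
  omega

open Polynomial in
theorem coeff_reflBasis (k b : ℕ) : (reflBasis k b).coeff (b + 2 * k) = 2 ^ b := by
  have h₁ : (2 * X - 1 : ℚ[X]).natDegree ≤ 1 := by compute_degree
  have h₂ : (X * (X - 1) : ℚ[X]).natDegree ≤ 2 := by compute_degree
  have e₁ := coeff_pow_of_natDegree_le h₁ (m := b)
  have e₂ := coeff_pow_of_natDegree_le h₂ (m := k)
  have c₁ : (2 * X - 1 : ℚ[X]).coeff 1 = 2 := by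
    rw [← C_ofNat]; simp [coeff_one]
  have c₂ : (X * (X - 1) : ℚ[X]).coeff 2 = 1 := by
    rw [coeff_X_mul]; simp [coeff_one]
  rw [mul_one, c₁] at e₁
  rw [c₂, one_pow, mul_comm k] at e₂
  rw [reflBasis, coeff_mul_add_eq_of_natDegree_le
    ((natDegree_pow_le_of_le b h₁).trans (by simp))
    ((natDegree_pow_le_of_le k h₂).trans (by rw [mul_comm])), e₁, e₂, mul_one]

open PowerSeries in
/-- Eigenvectors of the involution `f(X) ↦ (1 - X) ^ (-2 * x - 1) * f(-X / (1 - X))`, listed by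
parity `b` of the order of vanishing at `0`. -/
noncomputable def mobiusBasis (x k b : ℕ) : ℚ⟦X⟧ :=
  (2 - X) ^ (1 - b) * X ^ (b + 2 * k) * PowerSeries.mk 1 ^ (x + 1 + k)

open PowerSeries in
theorem coeff_mobiusBasis_of_lt (x : ℕ) {r k b : ℕ} (h : r < b + 2 * k) :
    coeff r (mobiusBasis x k b) = 0 := by
  rw [mobiusBasis, mul_right_comm, coeff_mul_X_pow', if_neg (by omega)]

open PowerSeries in
theorem coeff_mobiusBasis (x k b : ℕ) :
    coeff (b + 2 * k) (mobiusBasis x k b) = 2 ^ (1 - b) := by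
  rw [mobiusBasis, mul_right_comm, coeff_mul_X_pow', if_pos le_rfl, Nat.sub_self,
    coeff_zero_eq_constantCoeff]
  simp [map_ofNat constantCoeff 2]

open PowerSeries in
theorem sum_C_mul_coeff (y m i : ℕ) {f : Polynomial ℚ} (hf : f.natDegree < m) :
    ∑ j : Fin m, C (y + i + j) i * f.coeff j =
      coeff i (PowerSeries.mk 1 ^ (y + 1) * Polynomial.aeval (PowerSeries.mk 1 : ℚ⟦X⟧) f) := by
  rw [Polynomial.aeval_eq_sum_range' hf, mul_sum, map_sum,
    Fin.sum_univ_eq_sum_range (fun j => C (y + i + j) i * f.coeff j)]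
  refine sum_congr rfl fun j _ => ?_
  rw [mul_smul_comm, ← pow_add, show y + 1 + j = y + j + 1 by ring, mk_one_pow_eq_mk_choose_add,
    coeff_smul, PowerSeries.coeff_mk, C_natCast, Nat.choose_symm_add, smul_eq_mul, mul_comm,
    show y + j + i = y + i + j by ring]

/-- The entries of the (transposed) matrix of `T` for `b = 0`, and of the matrix of `R` for
`b = 1`. -/
def blockEntry (x : ℕ) (b : Fin 2) (i k : ℕ) : ℚ :=
  if b = 0 then C (x + i + k) (2 * i - k)
  else C (x + i + k) (2 * i - k) + 2 * C (x + i + k + 2) (2 * i - k + 1)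

open PowerSeries in
theorem sum_blockEntry_smul_mobiusBasis (x k L : ℕ) (b : Fin 2) (hL : x + 2 * k + 2 ≤ L) :
    ∑ i ∈ range L, blockEntry x b i k • mobiusBasis x i b =
      (reflBasis k b : ℚ⟦X⟧) +
        PowerSeries.mk 1 ^ (2 * x + 1) * Polynomial.aeval (PowerSeries.mk 1) (reflBasis k b) := by
  have hu := mk_one_mul_one_sub_eq_one ℚ
  have h2 : (2 - X : ℚ⟦X⟧) ≠ 0 := fun h => by
    have := congrArg constantCoeff h
    rw [map_sub, constantCoeff_X, map_ofNat] at this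
    norm_num at this
  fin_cases b
  · simpa [blockEntry, mobiusBasis, reflBasis] using
      sum_C_smul_mul_X_pow_even X_ne_zero hu x k L (by omega)
  · simpa [blockEntry, mobiusBasis, reflBasis, add_comm 1,
      map_ofNat (Polynomial.aeval (PowerSeries.mk 1 : ℚ⟦X⟧)) 2,
      show ((2 : Polynomial ℚ) : ℚ⟦X⟧) = 2 from
        map_ofNat Polynomial.coeToPowerSeries.ringHom 2] using
      sum_C_add_two_mul_C_smul_X_pow_odd h2 hu x k L hL

open PowerSeries in
theorem sum_coeff_mobiusBasis_mul_blockEntry (x n k r : ℕ) (b : Fin 2) (hr : r < 2 * n) :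
    ∑ i : Fin n, coeff r (mobiusBasis x i b) * blockEntry x b i k =
      (reflBasis k b).coeff r +
        coeff r (PowerSeries.mk 1 ^ (2 * x + 1) *
          Polynomial.aeval (PowerSeries.mk 1 : ℚ⟦X⟧) (reflBasis k b)) := by
  have h := congrArg (coeff r)
    (sum_blockEntry_smul_mobiusBasis x k (n + (x + 2 * k + 2)) b (by omega))
  rw [map_add, Polynomial.coeff_coe, map_sum] at h
  rw [← h, Fin.sum_univ_eq_sum_range (fun i => coeff r (mobiusBasis x i b) * blockEntry x b i k)]
  rw [← sum_subset (range_subset_range.2 (Nat.le_add_right n _))]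
  · exact sum_congr rfl fun i _ => by rw [coeff_smul, smul_eq_mul, mul_comm]
  · intro i _ hi
    rw [mem_range, not_lt] at hi
    rw [coeff_smul, coeff_mobiusBasis_of_lt x (by omega), smul_zero]

end Bases

section Matrices

/-- Splitting the indices `0, …, 2 * n - 1` by parity. -/
def parityEquiv (n : ℕ) : Fin n × Fin 2 ≃ Fin (2 * n) :=
  finProdFinEquiv.trans (finCongr (mul_comm n 2))

theorem parityEquiv_val (n : ℕ) (p : Fin n × Fin 2) :
    (parityEquiv n p : ℕ) = p.2 + 2 * p.1 := by
  simp [parityEquiv]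

theorem parityEquiv_symm_val (n : ℕ) (i : Fin (2 * n)) :
    (i : ℕ) = ((parityEquiv n).symm i).2 + 2 * ((parityEquiv n).symm i).1 := by
  rw [← parityEquiv_val, Equiv.apply_symm_apply]

/-- The coefficient matrix of `reflBasis`. -/
noncomputable def reflMatrix (n : ℕ) : Matrix (Fin (2 * n)) (Fin (2 * n)) ℚ :=
  fun r c => (reflBasis ((parityEquiv n).symm c).1 ((parityEquiv n).symm c).2).coeff r

/-- The coefficient matrix of `mobiusBasis`. -/
noncomputable def mobiusMatrix (n x : ℕ) : Matrix (Fin (2 * n)) (Fin (2 * n)) ℚ :=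
  fun r c => PowerSeries.coeff r
    (mobiusBasis x ((parityEquiv n).symm c).1 ((parityEquiv n).symm c).2)

theorem det_reflMatrix (n : ℕ) : (reflMatrix n).det = 2 ^ n := by
  rw [Matrix.det_of_isUpperTriangular, ← (parityEquiv n).prod_comp, Fintype.prod_prod_type]
  · simp [reflMatrix, parityEquiv_val, coeff_reflBasis, Fin.prod_univ_two]
  · intro r c hrc
    refine Polynomial.coeff_eq_zero_of_natDegree_lt ((natDegree_reflBasis_le _ _).trans_lt ?_)
    rw [← parityEquiv_symm_val]
    exact hrc

theorem det_mobiusMatrix (n x : ℕ) : (mobiusMatrix n x).det = 2 ^ n := by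
  rw [Matrix.det_of_isLowerTriangular, ← (parityEquiv n).prod_comp, Fintype.prod_prod_type]
  · simp [mobiusMatrix, parityEquiv_val, coeff_mobiusBasis, Fin.prod_univ_two]
  · intro r c hrc
    refine coeff_mobiusBasis_of_lt x ?_
    rw [← parityEquiv_symm_val]
    exact hrc

/-- The block diagonal matrix representing `1 + (C (2 * x + i + j) i)` with respect to
`reflBasis` and `mobiusBasis`. -/
def blockMatrix (n x : ℕ) : Matrix (Fin (2 * n)) (Fin (2 * n)) ℚ :=
  Matrix.reindex (parityEquiv n) (parityEquiv n)
    (Matrix.blockDiagonal fun b => Matrix.of fun i k : Fin n => blockEntry x b i k)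

theorem det_blockMatrix (n x : ℕ) : (blockMatrix n x).det = T n x * R n x := by
  rw [blockMatrix, Matrix.det_reindex_self, Matrix.det_blockDiagonal, Fin.prod_univ_two,
    ← Matrix.det_transpose, T, R]
  congr 2
  ext i k
  simp [blockEntry, add_right_comm]

theorem mul_reflMatrix_eq (n x : ℕ) :
    Matrix.of (fun i j : Fin (2 * n) =>
      (if i = j then (1 : ℚ) else 0) + C (2 * x + i + j) i) * reflMatrix n =
        mobiusMatrix n x * blockMatrix n x := by
  ext r c
  obtain ⟨⟨k, b⟩, rfl⟩ := (parityEquiv n).surjective c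
  rw [Matrix.mul_apply, Matrix.mul_apply, ← (parityEquiv n).sum_comp
    fun j => mobiusMatrix n x r j * _, Fintype.sum_prod_type]
  have hdeg : (reflBasis k b).natDegree < 2 * n :=
    (natDegree_reflBasis_le _ _).trans_lt (by omega)
  simp [reflMatrix, mobiusMatrix, blockMatrix, Matrix.blockDiagonal_apply, add_mul,
    sum_add_distrib, sum_C_mul_coeff _ _ _ hdeg, sum_coeff_mobiusBasis_mul_blockEntry x n k r b r.2]

end Matrices

theorem Z_even_eq_T_mul_R (n x : ℕ) : Z (2 * n) (2 * x) = T n x * R n x := by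
  have h := congrArg Matrix.det (mul_reflMatrix_eq n x)
  rw [Matrix.det_mul, Matrix.det_mul, det_reflMatrix, det_mobiusMatrix, det_blockMatrix,
    mul_comm] at h
  exact mul_left_cancel₀ (pow_ne_zero n two_ne_zero) h
end

section
/- For all nonnegative integers n and x, Z_{2n+1}(2x) = 2 · T_{n+1}(x) · R_n(x). -/
open Finset

namespace CyclicDet

open PowerSeries (binomialSeries coeff)

/-- The power series `(1 + X) ^ e` for an integer exponent `e`. -/
noncomputable def binom (e : ℤ) : PowerSeries ℚ := binomialSeries ℚ e

theorem binom_add (a b : ℤ) : binom (a + b) = binom a * binom b :=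
  PowerSeries.binomialSeries_add a b

@[simp]
theorem constantCoeff_binom (e : ℤ) : PowerSeries.constantCoeff (binom e) = 1 :=
  PowerSeries.binomialSeries_constantCoeff e

theorem coeff_binom_eq_neg_one_pow_mul_choose {e : ℤ} {s N : ℕ} (h : e + N + 1 = s) :
    coeff s (binom e) = (-1) ^ s * (N.choose s : ℚ) := by
  obtain rfl : e = -(N + 1 - s : ℤ) := by omega
  rw [binom, PowerSeries.binomialSeries_coeff, Ring.choose_neg,
    show (N + 1 - s : ℤ) + s - 1 = N by ring, Ring.choose_natCast, Units.smul_def]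
  simp

theorem coeff_binom_natCast (N s : ℕ) : coeff s (binom N) = (N.choose s : ℚ) := by
  rw [binom, PowerSeries.binomialSeries_coeff, Ring.choose_natCast]
  simp

theorem binom_pow (e : ℤ) (k : ℕ) : binom e ^ k = binom (k * e) := by
  induction k with
  | zero => simp [binom]
  | succ k ih =>
    rw [pow_succ, ih, ← binom_add]
    congr 1
    push_cast
    ring

theorem binom_one : binom 1 = 1 + PowerSeries.X := by
  simpa [binom] using PowerSeries.binomialSeries_nat (R := ℤ) (A := ℚ) 1

theorem binom_neg_one_mul : binom (-1) * (1 + PowerSeries.X) = 1 := by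
  rw [← binom_one, ← binom_add]
  simp [binom]

theorem coeff_mul_neg_X_pow (G : PowerSeries ℚ) (d i : ℕ) :
    coeff d (G * (-PowerSeries.X) ^ i) = (-1) ^ i * if i ≤ d then coeff (d - i) G else 0 := by
  rw [neg_pow, mul_left_comm, show ((-1 : PowerSeries ℚ) ^ i) = PowerSeries.C ((-1) ^ i) by simp,
    PowerSeries.coeff_C_mul, PowerSeries.coeff_mul_X_pow']

theorem sum_coeff_mul_neg_X_pow_mul (G F : PowerSeries ℚ) {d m : ℕ} (hd : d < m) :
    ∑ i : Fin m, coeff d (G * (-PowerSeries.X) ^ (i : ℕ)) * ((-1) ^ (i : ℕ) * coeff i F) =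
      coeff d (G * F) := by
  rw [Fin.sum_univ_eq_sum_range
    (fun i => coeff d (G * (-PowerSeries.X) ^ i) * ((-1) ^ i * coeff i F)), mul_comm G F,
    PowerSeries.coeff_mul, Finset.Nat.sum_antidiagonal_eq_sum_range_succ_mk,
    ← Finset.sum_subset (Finset.range_subset_range.2 hd)]
  · refine Finset.sum_congr rfl fun i hi => ?_
    have hi' : i ≤ d := by simpa [Nat.lt_succ_iff] using hi
    have h1 : ((-1 : ℚ) ^ i) * (-1) ^ i = 1 := by rw [← mul_pow]; simp
    rw [coeff_mul_neg_X_pow, if_pos hi']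
    linear_combination (coeff (d - i) G * coeff i F) * h1
  · intro i _ hi
    have hi' : ¬ i ≤ d := by simpa [Nat.lt_succ_iff] using hi
    rw [coeff_mul_neg_X_pow, if_neg hi']
    simp

theorem sum_coeff_mul_pow_mul_coeff (G V : PowerSeries ℚ) (d : ℕ) {m : ℕ} {a : Polynomial ℚ}
    (ha : a.natDegree < m) :
    ∑ l : Fin m, coeff d (G * V ^ (l : ℕ)) * a.coeff l = coeff d (G * Polynomial.aeval V a) := by
  rw [Fin.sum_univ_eq_sum_range (fun l => coeff d (G * V ^ l) * a.coeff l),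
    Polynomial.aeval_eq_sum_range' ha, Finset.mul_sum, map_sum]
  refine Finset.sum_congr rfl fun l _ => ?_
  rw [mul_smul_comm, PowerSeries.coeff_smul, smul_eq_mul, mul_comm]

/-- The matrix whose determinant is `Z m y`. -/
def zMatrix (m y : ℕ) : Matrix (Fin m) (Fin m) ℚ := fun i j =>
  (if i = j then (1 : ℚ) else 0) + C (y + (i : ℕ) + (j : ℕ)) (i : ℤ)

theorem sum_coeff_mul_zMatrix (G : PowerSeries ℚ) (y : ℕ) {d m : ℕ} (hd : d < m) (l : Fin m) :
    ∑ i : Fin m, coeff d (G * (-PowerSeries.X) ^ (i : ℕ)) * zMatrix m y i l =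
      coeff d (G * (-PowerSeries.X) ^ (l : ℕ)) +
        coeff d (G * binom (-(y + 1)) * binom (-1) ^ (l : ℕ)) := by
  simp only [zMatrix, mul_add, Finset.sum_add_distrib]
  congr 1
  · simp
  · rw [mul_assoc, binom_pow, ← binom_add,
      ← sum_coeff_mul_neg_X_pow_mul G _ hd]
    refine Finset.sum_congr rfl fun i _ => ?_
    rw [coeff_binom_eq_neg_one_pow_mul_choose (N := y + i + l) (by push_cast; ring),
      ← mul_assoc ((-1 : ℚ) ^ (i : ℕ)), ← mul_pow]
    simp [C]

/-- Power series encoding the linear functionals on the left of the factorization. -/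
noncomputable def rowSeries (x i : ℕ) : PowerSeries ℚ :=
  (if i % 2 = 0 then 1 else 2 + PowerSeries.X) * binom (x + (i / 2 : ℕ))

/-- Eigenvectors of the involution `t ↦ 1 - t` on polynomials. -/
noncomputable def colPoly (k : ℕ) : Polynomial ℚ :=
  (if k % 2 = 0 then 1 else 2 * Polynomial.X - 1) *
    (Polynomial.X * (Polynomial.X - 1)) ^ (k / 2)

theorem natDegree_colPoly_le (k : ℕ) : (colPoly k).natDegree ≤ k := by
  have h1 : (Polynomial.X * (Polynomial.X - 1) : Polynomial ℚ).natDegree ≤ 2 := by compute_degree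
  have h2 := Polynomial.natDegree_pow_le_of_le (k / 2) h1
  have h3 : (2 * Polynomial.X - 1 : Polynomial ℚ).natDegree ≤ 1 := by compute_degree
  unfold colPoly
  split_ifs with h
  · rw [one_mul]
    omega
  · have := Polynomial.natDegree_mul_le_of_le h3 h2
    omega

theorem coeff_colPoly_self (k : ℕ) : (colPoly k).coeff k = if k % 2 = 0 then 1 else 2 := by
  have h1 : (Polynomial.X * (Polynomial.X - 1) : Polynomial ℚ).natDegree ≤ 2 := by compute_degree
  have h2 := Polynomial.natDegree_pow_le_of_le (k / 2) h1
  have h3 : (2 * Polynomial.X - 1 : Polynomial ℚ).natDegree ≤ 1 := by compute_degree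
  have h4 : (Polynomial.X * (Polynomial.X - 1) : Polynomial ℚ).coeff 2 = 1 := by
    compute_degree!
  have h5 : (2 * Polynomial.X - 1 : Polynomial ℚ).coeff 1 = 2 := by compute_degree!
  have h6 :
      ((Polynomial.X * (Polynomial.X - 1) : Polynomial ℚ) ^ (k / 2)).coeff (k / 2 * 2) = 1 := by
    rw [Polynomial.coeff_pow_of_natDegree_le h1, h4, one_pow]
  unfold colPoly
  split_ifs with h
  · rw [one_mul]
    rwa [show k / 2 * 2 = k by omega] at h6
  · have := Polynomial.coeff_mul_add_eq_of_natDegree_le h3 h2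
    rwa [h5, h6, show 1 + k / 2 * 2 = k by omega, mul_one] at this

/-- Values of the functionals of `rowSeries`. -/
noncomputable def rowMatrix (m x : ℕ) : Matrix (Fin m) (Fin m) ℚ :=
  fun i l => coeff i (rowSeries x i * (-PowerSeries.X) ^ (l : ℕ))

/-- Coefficients of the polynomials `colPoly`. -/
noncomputable def colMatrix (m : ℕ) : Matrix (Fin m) (Fin m) ℚ :=
  fun l k => (colPoly k).coeff l

theorem rowMatrix_mul_zMatrix_mul_colMatrix (m x y : ℕ) (i k : Fin m) :
    (rowMatrix m x * zMatrix m y * colMatrix m) i k =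
      coeff i (rowSeries x i * Polynomial.aeval (-PowerSeries.X) (colPoly k)) +
      coeff i (rowSeries x i * binom (-(y + 1)) * Polynomial.aeval (binom (-1)) (colPoly k)) := by
  have hk : (colPoly k).natDegree < m := (natDegree_colPoly_le k).trans_lt k.2
  rw [Matrix.mul_apply, ← sum_coeff_mul_pow_mul_coeff _ _ _ hk,
    ← sum_coeff_mul_pow_mul_coeff _ _ _ hk, ← Finset.sum_add_distrib]
  refine Finset.sum_congr rfl fun l _ => ?_
  rw [Matrix.mul_apply, ← add_mul]
  congr 1
  exact sum_coeff_mul_zMatrix _ _ i.2 l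

/-- Separation of the even and the odd indices. -/
noncomputable def parityEquiv (n : ℕ) : Fin (n + 1) ⊕ Fin n ≃ Fin (2 * n + 1) :=
  Equiv.ofBijective
    (Sum.elim (fun j => ⟨2 * j, by omega⟩) (fun j => ⟨2 * j + 1, by omega⟩)) <| by
    rw [Fintype.bijective_iff_injective_and_card]
    constructor
    · rintro (i | i) (j | j) h <;> simp [Fin.ext_iff] at h ⊢ <;> omega
    · simp
      omega

@[simp]
theorem val_parityEquiv_inl {n : ℕ} (j : Fin (n + 1)) :
    (parityEquiv n (Sum.inl j) : ℕ) = 2 * j := rfl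

@[simp]
theorem val_parityEquiv_inr {n : ℕ} (j : Fin n) :
    (parityEquiv n (Sum.inr j) : ℕ) = 2 * j + 1 := rfl

theorem prod_ite_even (n : ℕ) (c : ℚ) :
    ∏ i : Fin (2 * n + 1), (if (i : ℕ) % 2 = 0 then 1 else c) = c ^ n := by
  rw [← (parityEquiv n).prod_comp, Fintype.prod_sum_type]
  simp [Nat.add_mod]

theorem det_rowMatrix (n x : ℕ) : (rowMatrix (2 * n + 1) x).det = (-2) ^ n := by
  rw [Matrix.det_of_isLowerTriangular, ← prod_ite_even]
  · refine Finset.prod_congr rfl fun i _ => ?_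
    rw [rowMatrix, coeff_mul_neg_X_pow, if_pos le_rfl, Nat.sub_self, rowSeries]
    split_ifs with h
    · simp [Even.neg_one_pow (Nat.even_iff.2 h)]
    · simp [Odd.neg_one_pow (Nat.odd_iff.2 (Nat.mod_two_ne_zero.1 h)), map_ofNat]
  · intro i l h
    have h' : (i : ℕ) < l := h
    rw [rowMatrix, coeff_mul_neg_X_pow, if_neg (by omega), mul_zero]

theorem det_colMatrix (n : ℕ) : (colMatrix (2 * n + 1)).det = 2 ^ n := by
  rw [Matrix.det_of_isUpperTriangular, ← prod_ite_even]
  · exact Finset.prod_congr rfl fun i _ => coeff_colPoly_self i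
  · intro l k h
    exact Polynomial.coeff_eq_zero_of_natDegree_lt ((natDegree_colPoly_le k).trans_lt h)

theorem aeval_neg_X_colPoly_even (k : ℕ) :
    Polynomial.aeval (-PowerSeries.X : PowerSeries ℚ) (colPoly (2 * k)) =
      PowerSeries.X ^ k * binom k := by
  rw [binom, PowerSeries.binomialSeries_nat, ← mul_pow]
  simp only [colPoly, Nat.mul_mod_right, if_true, one_mul, Nat.mul_div_cancel_left k two_pos,
    map_pow, map_mul, map_sub, Polynomial.aeval_X, map_one]
  ring

theorem aeval_binom_colPoly_even (k : ℕ) :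
    Polynomial.aeval (binom (-1)) (colPoly (2 * k)) =
      (-1 : ℚ) ^ k • (PowerSeries.X ^ k * binom (-(2 * k))) := by
  have h : binom (-1) * (binom (-1) - 1) = (-1 : ℚ) • (PowerSeries.X * binom (-1) ^ 2) := by
    rw [neg_one_smul]
    linear_combination binom (-1) * binom_neg_one_mul
  simp only [colPoly, Nat.mul_mod_right, if_true, one_mul, Nat.mul_div_cancel_left k two_pos,
    map_pow, map_mul, map_sub, Polynomial.aeval_X, map_one]
  rw [h, smul_pow, mul_pow, ← pow_mul, binom_pow]
  congr 3
  push_cast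
  ring

theorem colPoly_odd (k : ℕ) :
    colPoly (2 * k + 1) = (2 * Polynomial.X - 1) * colPoly (2 * k) := by
  simp [colPoly, Nat.add_mod, show (2 * k + 1) / 2 = k by omega]

theorem aeval_two_mul_X_sub_one (V : PowerSeries ℚ) :
    Polynomial.aeval V (2 * Polynomial.X - 1 : Polynomial ℚ) = 2 * V - 1 := by
  rw [two_mul, two_mul]
  simp

theorem aeval_neg_X_colPoly_odd (k : ℕ) :
    Polynomial.aeval (-PowerSeries.X : PowerSeries ℚ) (colPoly (2 * k + 1)) =
      -(1 + 2 * PowerSeries.X) * (PowerSeries.X ^ k * binom k) := by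
  rw [colPoly_odd, map_mul, aeval_neg_X_colPoly_even, aeval_two_mul_X_sub_one]
  ring

theorem aeval_binom_colPoly_odd (k : ℕ) :
    Polynomial.aeval (binom (-1)) (colPoly (2 * k + 1)) =
      (-1 : ℚ) ^ k • ((1 - PowerSeries.X) * (PowerSeries.X ^ k * binom (-(2 * k) - 1))) := by
  have h : 2 * binom (-1) - 1 = (1 - PowerSeries.X) * binom (-1) := by
    linear_combination binom_neg_one_mul
  rw [colPoly_odd, map_mul, aeval_binom_colPoly_even, aeval_two_mul_X_sub_one, h,
    sub_eq_add_neg (-(2 * k : ℤ)), binom_add, mul_smul_comm]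
  congr 1
  ring

theorem rowSeries_even (x j : ℕ) : rowSeries x (2 * j) = binom (x + j) := by
  simp [rowSeries]

theorem rowSeries_odd (x j : ℕ) :
    rowSeries x (2 * j + 1) = (2 + PowerSeries.X) * binom (x + j) := by
  simp [rowSeries, Nat.add_mod, show (2 * j + 1) / 2 = j by omega]

theorem C_succ (N : ℕ) (z : ℤ) : C (N + 1) z = C N z + C N (z - 1) := by
  rcases lt_trichotomy z 0 with h | rfl | h
  · simp [C, h.not_ge, show ¬ 1 ≤ z by omega]
  · simp [C]
  · obtain ⟨s, rfl⟩ : ∃ s : ℕ, z = s + 1 := ⟨(z - 1).toNat, by omega⟩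
    rw [add_sub_cancel_right]
    simp only [C, if_pos h.le, if_pos (Int.natCast_nonneg s), Int.toNat_natCast,
      show ((s : ℤ) + 1).toNat = s + 1 by omega, Nat.choose_succ_succ]
    push_cast
    ring

theorem coeff_X_pow_mul_binom_natCast {d k : ℕ} {e z : ℤ} (N : ℕ) (he : e = N)
    (hz : z = d - k) : coeff d (PowerSeries.X ^ k * binom e) = C N z := by
  subst he hz
  rw [PowerSeries.coeff_X_pow_mul']
  split_ifs with h
  · rw [coeff_binom_natCast, C, if_pos (by omega), show ((d : ℤ) - k).toNat = d - k by omega]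
  · rw [C, if_neg (by omega)]

theorem coeff_X_pow_mul_binom_reflect {d k : ℕ} {e z : ℤ} (N : ℕ) (he : e + N + 1 = z)
    (hz : z = d - k) : coeff d (PowerSeries.X ^ k * binom e) = (-1) ^ (d + k) * C N z := by
  subst hz
  rw [PowerSeries.coeff_X_pow_mul']
  split_ifs with h
  · rw [coeff_binom_eq_neg_one_pow_mul_choose (N := N) (by omega), C, if_pos (by omega),
      show ((d : ℤ) - k).toNat = d - k by omega, show d + k = d - k + 2 * k by omega, pow_add,
      pow_mul]
    simp
  · rw [C, if_neg (by omega), mul_zero]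

theorem binom_mul_binom_mul {a b c : ℤ} {F : PowerSeries ℚ} (h : a + b = c) :
    binom a * (F * binom b) = F * binom c := by
  rw [← h, binom_add]
  ring

theorem neg_one_pow_mul_neg_one_pow_even (j k : ℕ) :
    (-1 : ℚ) ^ k * (-1) ^ (2 * j + k) = 1 := by
  rw [← pow_add, show k + (2 * j + k) = 2 * (j + k) by ring, pow_mul]
  simp

/-- The entries of the product of `rowMatrix`, `zMatrix` and `colMatrix`, for `y = 2 * x`. -/
noncomputable def pairing (x i k : ℕ) : ℚ :=
  coeff i (rowSeries x i * Polynomial.aeval (-PowerSeries.X) (colPoly k)) +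
    coeff i (rowSeries x i * binom (-(2 * x + 1)) * Polynomial.aeval (binom (-1)) (colPoly k))

theorem pairing_even_even (x j k : ℕ) :
    pairing x (2 * j) (2 * k) = 2 * C (x + k + j) (2 * (j : ℤ) - k) := by
  have h1 : binom (x + j) * (PowerSeries.X ^ k * binom k) =
      PowerSeries.X ^ k * binom (x + k + j) := binom_mul_binom_mul (by ring)
  have h2 : binom (x + j) * binom (-(2 * x + 1)) * (PowerSeries.X ^ k * binom (-(2 * k))) =
      PowerSeries.X ^ k * binom (j - x - 1 - 2 * k) := by
    rw [← binom_add]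
    exact binom_mul_binom_mul (by ring)
  rw [pairing, rowSeries_even, aeval_neg_X_colPoly_even, aeval_binom_colPoly_even, h1,
    mul_smul_comm, h2, PowerSeries.coeff_smul, smul_eq_mul,
    coeff_X_pow_mul_binom_natCast (x + k + j) (z := 2 * j - k) (by push_cast; ring)
      (by push_cast; ring),
    coeff_X_pow_mul_binom_reflect (x + k + j) (z := 2 * j - k) (by push_cast; ring)
      (by push_cast; ring), ← mul_assoc, neg_one_pow_mul_neg_one_pow_even]
  ring

theorem pairing_even_odd (x j k : ℕ) : pairing x (2 * j) (2 * k + 1) = 0 := by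
  set b := binom (x + k + j) with hb
  set c := binom (j - x - 2 - 2 * k) with hc
  have h1 : binom (x + j) * (-(1 + 2 * PowerSeries.X) * (PowerSeries.X ^ k * binom k)) =
      -(PowerSeries.X ^ k * b + PowerSeries.X ^ (k + 1) * b + PowerSeries.X ^ (k + 1) * b) := by
    rw [hb, show (x + k + j : ℤ) = (x + j) + k by ring, binom_add (_ + _)]
    ring
  have h2 : binom (x + j) * binom (-(2 * x + 1)) *
      ((1 - PowerSeries.X) * (PowerSeries.X ^ k * binom (-(2 * k) - 1))) =
      PowerSeries.X ^ k * c - PowerSeries.X ^ (k + 1) * c := by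
    rw [hc, show (j - x - 2 - 2 * k : ℤ) = (x + j) + -(2 * x + 1) + (-(2 * k) - 1) by ring,
      binom_add (_ + _), binom_add (_ + _)]
    ring
  have hN := neg_one_pow_mul_neg_one_pow_even j k
  have hC := C_succ (x + k + j) (2 * j - k)
  rw [pairing, rowSeries_even, aeval_neg_X_colPoly_odd, aeval_binom_colPoly_odd, h1,
    mul_smul_comm, h2, PowerSeries.coeff_smul, smul_eq_mul, map_neg, map_add, map_add, map_sub,
    coeff_X_pow_mul_binom_natCast (x + k + j) (z := 2 * j - k) (by push_cast; ring)
      (by push_cast; ring),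
    coeff_X_pow_mul_binom_natCast (x + k + j) (z := 2 * j - k - 1) (by push_cast; ring)
      (by push_cast; ring),
    coeff_X_pow_mul_binom_reflect (x + k + j + 1) (z := 2 * j - k) (by push_cast; ring)
      (by push_cast; ring),
    coeff_X_pow_mul_binom_reflect (x + k + j) (z := 2 * j - k - 1) (by push_cast; ring)
      (by push_cast; ring), hC, ← add_assoc, pow_succ (-1 : ℚ)]
  linear_combination (C (x + k + j) (2 * j - k) + 2 * C (x + k + j) (2 * j - k - 1)) * hN

theorem pairing_odd_even (x j k : ℕ) : pairing x (2 * j + 1) (2 * k) = 0 := by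
  set b := binom (x + k + j) with hb
  set c := binom (j - x - 1 - 2 * k) with hc
  have h1 : (2 + PowerSeries.X) * binom (x + j) * (PowerSeries.X ^ k * binom k) =
      PowerSeries.X ^ k * b + PowerSeries.X ^ k * b + PowerSeries.X ^ (k + 1) * b := by
    rw [hb, show (x + k + j : ℤ) = (x + j) + k by ring, binom_add (_ + _)]
    ring
  have h2 : (2 + PowerSeries.X) * binom (x + j) * binom (-(2 * x + 1)) *
      (PowerSeries.X ^ k * binom (-(2 * k))) =
      PowerSeries.X ^ k * c + PowerSeries.X ^ k * c + PowerSeries.X ^ (k + 1) * c := by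
    rw [hc, show (j - x - 1 - 2 * k : ℤ) = (x + j) + -(2 * x + 1) + -(2 * k) by ring,
      binom_add (_ + _), binom_add (_ + _)]
    ring
  have hN := neg_one_pow_mul_neg_one_pow_even j k
  have hC := C_succ (x + k + j) (2 * j + 1 - k)
  rw [pairing, rowSeries_odd, aeval_neg_X_colPoly_even, aeval_binom_colPoly_even, h1,
    mul_smul_comm, h2, PowerSeries.coeff_smul, smul_eq_mul, map_add, map_add, map_add, map_add,
    coeff_X_pow_mul_binom_natCast (x + k + j) (z := 2 * j + 1 - k) (by push_cast; ring)
      (by push_cast; ring),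
    coeff_X_pow_mul_binom_natCast (x + k + j) (z := 2 * j + 1 - k - 1) (by push_cast; ring)
      (by push_cast; ring),
    coeff_X_pow_mul_binom_reflect (x + k + j + 1) (z := 2 * j + 1 - k) (by push_cast; ring)
      (by push_cast; ring),
    coeff_X_pow_mul_binom_reflect (x + k + j) (z := 2 * j + 1 - k - 1) (by push_cast; ring)
      (by push_cast; ring), hC, show 2 * j + 1 + (k + 1) = 2 * j + k + 1 + 1 by ring,
    show 2 * j + 1 + k = 2 * j + k + 1 by ring, pow_succ (-1 : ℚ), pow_succ (-1 : ℚ)]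
  linear_combination
    (-2 * C (x + k + j) (2 * j + 1 - k) - C (x + k + j) (2 * j + 1 - k - 1)) * hN

theorem pairing_odd_odd (x j k : ℕ) :
    pairing x (2 * j + 1) (2 * k + 1) =
      -2 * (C (x + j + k) (2 * (j : ℤ) - k) + 2 * C (x + j + k + 2) (2 * (j : ℤ) - k + 1)) := by
  set b := binom (x + j + k) with hb
  set b' := binom (x + j + k + 2) with hb'
  set c := binom (j - x - 2 - 2 * k) with hc
  have h1 : (2 + PowerSeries.X) * binom (x + j) *
      (-(1 + 2 * PowerSeries.X) * (PowerSeries.X ^ k * binom k)) =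
      -(PowerSeries.X ^ k * b' + PowerSeries.X ^ k * b' + PowerSeries.X ^ (k + 1) * b) := by
    have h3 : b' = b * (1 + PowerSeries.X) ^ 2 := by
      rw [← binom_one, binom_pow, hb, hb', ← binom_add]
      norm_num
    rw [h3, hb, binom_add (_ + _)]
    ring
  have h2 : (2 + PowerSeries.X) * binom (x + j) * binom (-(2 * x + 1)) *
      ((1 - PowerSeries.X) * (PowerSeries.X ^ k * binom (-(2 * k) - 1))) =
      PowerSeries.X ^ k * c + PowerSeries.X ^ k * c - PowerSeries.X ^ (k + 1) * c -
        PowerSeries.X ^ (k + 2) * c := by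
    rw [hc, show (j - x - 2 - 2 * k : ℤ) = (x + j) + -(2 * x + 1) + (-(2 * k) - 1) by ring,
      binom_add (_ + _), binom_add (_ + _)]
    ring
  have hN := neg_one_pow_mul_neg_one_pow_even j k
  have hC := C_succ (x + j + k) (2 * j - k)
  rw [pairing, rowSeries_odd, aeval_neg_X_colPoly_odd, aeval_binom_colPoly_odd, h1,
    mul_smul_comm, h2, PowerSeries.coeff_smul, smul_eq_mul, map_neg, map_add, map_add, map_sub,
    map_sub, map_add,
    coeff_X_pow_mul_binom_natCast (x + j + k + 2) (z := 2 * j - k + 1) (by push_cast; ring)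
      (by push_cast; ring),
    coeff_X_pow_mul_binom_natCast (x + j + k) (z := 2 * j - k) (by push_cast; ring)
      (by push_cast; ring),
    coeff_X_pow_mul_binom_reflect (x + j + k + 2) (z := 2 * j - k + 1) (by push_cast; ring)
      (by push_cast; ring),
    coeff_X_pow_mul_binom_reflect (x + j + k + 1) (z := 2 * j - k) (by push_cast; ring)
      (by push_cast; ring),
    coeff_X_pow_mul_binom_reflect (x + j + k) (z := 2 * j - k - 1) (by push_cast; ring)
      (by push_cast; ring), hC, show 2 * j + 1 + (k + 2) = 2 * j + k + 1 + 1 + 1 by ring,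
    show 2 * j + 1 + (k + 1) = 2 * j + k + 1 + 1 by ring,
    show 2 * j + 1 + k = 2 * j + k + 1 by ring, pow_succ (-1 : ℚ), pow_succ (-1 : ℚ),
    pow_succ (-1 : ℚ)]
  linear_combination
    (-2 * C (x + j + k + 2) (2 * j - k + 1) - C (x + j + k) (2 * j - k)) * hN

/-- The matrix whose determinant is `T n x`. -/
def tMatrix (n x : ℕ) : Matrix (Fin n) (Fin n) ℚ := fun i j =>
  C (x + (i : ℕ) + (j : ℕ)) (2 * (j : ℤ) - (i : ℤ))

/-- The matrix whose determinant is `R n x`. -/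
def rMatrix (n x : ℕ) : Matrix (Fin n) (Fin n) ℚ := fun i j =>
  C (x + (i : ℕ) + (j : ℕ)) (2 * (i : ℤ) - (j : ℤ)) +
    2 * C (x + (i : ℕ) + (j : ℕ) + 2) (2 * (i : ℤ) - (j : ℤ) + 1)

theorem rowMatrix_mul_zMatrix_mul_colMatrix_submatrix (n x : ℕ) :
    (rowMatrix (2 * n + 1) x * zMatrix (2 * n + 1) (2 * x) * colMatrix (2 * n + 1)).submatrix
        (parityEquiv n) (parityEquiv n) =
      Matrix.fromBlocks
        ((2 : ℚ) • (tMatrix (n + 1) x).transpose) 0 0 ((-2 : ℚ) • rMatrix n x) := by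
  have h (i k : Fin (2 * n + 1)) :
      (rowMatrix (2 * n + 1) x * zMatrix (2 * n + 1) (2 * x) * colMatrix (2 * n + 1)) i k =
        pairing x i k := by
    rw [rowMatrix_mul_zMatrix_mul_colMatrix, pairing]
    push_cast
    rfl
  ext (i | i) (k | k) <;> rw [Matrix.submatrix_apply, h]
  · exact pairing_even_even x i k
  · exact pairing_even_odd x i k
  · exact pairing_odd_even x i k
  · exact pairing_odd_odd x i k

theorem neg_two_pow_mul_Z_mul_two_pow (n x : ℕ) :
    (-2) ^ n * Z (2 * n + 1) (2 * x) * 2 ^ n =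
      2 ^ (n + 1) * T (n + 1) x * ((-2) ^ n * R n x) := by
  have h := congrArg Matrix.det (rowMatrix_mul_zMatrix_mul_colMatrix_submatrix n x)
  rw [Matrix.det_submatrix_equiv_self, Matrix.det_mul, Matrix.det_mul, det_rowMatrix,
    det_colMatrix, Matrix.det_fromBlocks_zero₂₁, Matrix.det_smul, Matrix.det_smul,
    Matrix.det_transpose, Fintype.card_fin, Fintype.card_fin] at h
  exact h

end CyclicDet

theorem Z_odd_eq_two_T_mul_R (n x : ℕ) :
    Z (2 * n + 1) (2 * x) = 2 * T (n + 1) x * R n x := by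
  have h1 : ((-2 : ℚ) ^ n) ≠ 0 := pow_ne_zero n (by norm_num)
  have h2 : ((2 : ℚ) ^ n) ≠ 0 := by positivity
  refine mul_left_cancel₀ (mul_ne_zero h1 h2) ?_
  linear_combination CyclicDet.neg_two_pow_mul_Z_mul_two_pow n x
end

section
/- For all nonnegative integers n and x, 2 · T_{n+1}(x) · Z_{2n}(2x) = T_n(x) · Z_{2n+1}(2x). (Equivalently, twice the ratio CSTC(2n+2,2x)/CSTC(2n,2x) of numbers of cyclically symmetric transposed-complementary tilings equals the ratio CS(2n+1,2x)/CS(2n,2x) of numbers of cyclically symmetric tilings.) -/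
open Finset

/-! ### Determinants of triangular products and checkerboard matrices -/

theorem det_eq_prod_mul_det_of_lower {m : ℕ} {A L N : ℕ → ℕ → ℚ}
    (hL : ∀ i k, i < k → L i k = 0)
    (h : ∀ i < m, ∀ j < m, A i j = ∑ k ∈ range m, L i k * N k j) :
    Matrix.det (Matrix.of fun i j : Fin m => A i j) =
      (∏ i ∈ range m, L i i) * Matrix.det (Matrix.of fun i j : Fin m => N i j) := by
  have hmul : (Matrix.of fun i j : Fin m => A i j) =
      (Matrix.of fun i j : Fin m => L i j) * (Matrix.of fun i j : Fin m => N i j) := by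
    ext i j
    rw [Matrix.mul_apply]
    simp only [Matrix.of_apply]
    rw [h i i.2 j j.2, Finset.sum_range]
  have hdet := congrArg Matrix.det hmul
  rw [Matrix.det_mul, Matrix.det_of_isLowerTriangular (Matrix.of fun i j : Fin m => L i j)
    (fun i j hij => hL i j hij)] at hdet
  rw [Finset.prod_range]
  exact hdet

theorem det_eq_det_mul_prod_of_upper {m : ℕ} {A N U : ℕ → ℕ → ℚ}
    (hU : ∀ k j, j < k → U k j = 0)
    (h : ∀ i < m, ∀ j < m, A i j = ∑ k ∈ range m, N i k * U k j) :
    Matrix.det (Matrix.of fun i j : Fin m => A i j) =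
      (∏ i ∈ range m, U i i) * Matrix.det (Matrix.of fun i j : Fin m => N i j) := by
  have := det_eq_prod_mul_det_of_lower (m := m) (A := fun i j => A j i) (L := fun i k => U k i)
    (N := fun k j => N j k) (fun i k hik => hU k i hik)
    (fun i hi j hj => by rw [h j hj i hi]; exact Finset.sum_congr rfl fun k _ => mul_comm _ _)
  rw [← Matrix.det_transpose] at this
  rw [← Matrix.det_transpose (Matrix.of fun i j : Fin m => N i j)]
  exact this

/-- A matrix whose entries vanish at positions of odd index sum has determinant equal to the product
of the minors on even and on odd indices. -/
theorem det_checkerboard {m a b : ℕ} (hm : m = a + b) (hba : b ≤ a) (hab : a ≤ b + 1)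
    (N : ℕ → ℕ → ℚ) (h₁ : ∀ i j, N (2 * i) (2 * j + 1) = 0)
    (h₂ : ∀ i j, N (2 * i + 1) (2 * j) = 0) :
    Matrix.det (Matrix.of fun i j : Fin m => N i j) =
      Matrix.det (Matrix.of fun i j : Fin a => N (2 * i) (2 * j)) *
        Matrix.det (Matrix.of fun i j : Fin b => N (2 * i + 1) (2 * j + 1)) := by
  let f : Fin a ⊕ Fin b → Fin m :=
    Sum.elim (fun i => ⟨2 * i, by omega⟩) (fun i => ⟨2 * i + 1, by omega⟩)
  have hf : Function.Bijective f := by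
    rw [Fintype.bijective_iff_injective_and_card]
    refine ⟨?_, by simp [hm]⟩
    rintro (i | i) (j | j) hij <;> simp [f, Fin.ext_iff] at hij ⊢ <;> omega
  let e := Equiv.ofBijective f hf
  rw [← Matrix.det_submatrix_equiv_self e]
  have : Matrix.submatrix (Matrix.of fun i j : Fin m => N i j) e e =
      Matrix.fromBlocks (Matrix.of fun i j : Fin a => N (2 * i) (2 * j)) 0 0
        (Matrix.of fun i j : Fin b => N (2 * i + 1) (2 * j + 1)) := by
    ext (i | i) (j | j) <;> simp [Matrix.submatrix, e, f, h₁, h₂]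
  rw [this, Matrix.det_fromBlocks_zero₁₂]

theorem sum_range_two_mul (f : ℕ → ℚ) (m : ℕ) :
    ∑ k ∈ range (2 * m), f k = ∑ k ∈ range m, (f (2 * k) + f (2 * k + 1)) := by
  induction m with
  | zero => simp
  | succ m ih => rw [Nat.mul_succ, sum_range_succ, sum_range_succ, sum_range_succ, ih]; ring

/-! ### Binomial recurrences -/

theorem C_succ (m : ℕ) (k : ℤ) : C (m + 1) k = C m (k - 1) + C m k := by
  obtain hk | rfl | hk := lt_trichotomy k 0
  · simp [C, hk.not_ge, show ¬ (1 ≤ k) by omega]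
  · simp [C]
  · obtain ⟨l, rfl⟩ : ∃ l : ℕ, k = l + 1 := ⟨(k - 1).toNat, by omega⟩
    have h0 : (0 : ℤ) ≤ l + 1 := by omega
    have h1 : ((l : ℤ) + 1).toNat = l + 1 := by omega
    simp [C, h0, h1, Nat.choose_succ_succ]

/-! ### Expansion in powers of `X² / (1 - Polynomial.X)` -/

section Expansion

open scoped Polynomial

variable {A : Type*} [CommRing A] [Algebra ℚ A]

theorem exists_aeval_even {t w z : A} (htw : t * w = 1) (hz : z = 1 - t) (a b : ℕ) :
    ∃ p : ℚ[X], (-z) ^ a * t ^ b + z ^ a * w ^ (a + b + 1) = (1 + w) * Polynomial.aeval (z ^ 2 * w) p ∧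
      ∀ k : ℕ, p.coeff k = C (b + k) (2 * k - a) := by
  have hu : z ^ 2 * w = t + w - 2 := by
    subst hz; linear_combination (t - 2) * htw
  induction a generalizing b with
  | zero =>
    induction b using Nat.twoStepInduction with
    | zero =>
      refine ⟨1, by simp, fun k => ?_⟩
      rcases k with _ | k
      · simp [C]
      · have : (2 * ((k : ℤ) + 1)).toNat = 2 * k + 2 := by omega
        have h0 : (0 : ℤ) ≤ 2 * (k + 1) := by omega
        simp [C, Polynomial.coeff_one, this, h0]
        rw [Nat.choose_eq_zero_of_lt (by omega), Nat.cast_zero]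
    | one =>
      refine ⟨1 + Polynomial.X, ?_, fun k => ?_⟩
      · simp only [map_add, map_one, Polynomial.aeval_X, hu]
        linear_combination -htw
      · rcases k with _ | _ | k
        · simp [C]
        · simp [C, Polynomial.coeff_X, Polynomial.coeff_one]
        · have : (2 * ((k : ℤ) + 1 + 1)).toNat = 2 * k + 4 := by omega
          have h0 : (0 : ℤ) ≤ 2 * (k + 1 + 1) := by omega
          simp [C, Polynomial.coeff_one, Polynomial.coeff_X, this, h0]
          rw [Nat.choose_eq_zero_of_lt (by omega), Nat.cast_zero]
    | more b ih₀ ih₁ =>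
      obtain ⟨p₀, h₀, c₀⟩ := ih₀
      obtain ⟨p₁, h₁, c₁⟩ := ih₁
      refine ⟨(2 + Polynomial.X) * p₁ - p₀, ?_, fun k => ?_⟩
      · simp only [map_add, map_sub, map_mul, map_ofNat, Polynomial.aeval_X]
        rw [mul_sub, mul_left_comm, ← h₀, ← h₁, hu]
        simp only [zero_add, pow_zero, one_mul, pow_succ]
        linear_combination (t ^ b + w ^ b * w) * (-htw)
      · rw [add_mul, Polynomial.coeff_sub, Polynomial.coeff_add, ← Polynomial.C_ofNat, Polynomial.coeff_C_mul]
        rcases k with _ | k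
        · have := c₀ 0
          have := c₁ 0
          simp_all [C]
          norm_num
        · rw [Polynomial.coeff_X_mul, c₀, c₁, c₁]
          have e1 : b + 2 + (k + 1) = b + k + 1 + 1 + 1 := by ring
          have e2 : b + 1 + (k + 1) = b + k + 1 + 1 := by ring
          have e3 : b + (k + 1) = b + k + 1 := by ring
          have e4 : b + 1 + k = b + k + 1 := by ring
          rw [e1, e2, e3, e4]
          simp only [C_succ (b + k + 1 + 1), C_succ (b + k + 1) ]
          push_cast
          ring_nf
  | succ a ih =>
    obtain ⟨p₀, h₀, c₀⟩ := ih b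
    obtain ⟨p₁, h₁, c₁⟩ := ih (b + 1)
    refine ⟨p₁ - p₀, ?_, fun k => ?_⟩
    · rw [map_sub, mul_sub, ← h₀, ← h₁]
      have e : a + 1 + b + 1 = a + b + 1 + 1 := by ring
      rw [e, ← add_assoc a b 1]
      subst hz
      simp only [pow_succ]
      linear_combination (-(1 - t) ^ a * w ^ a * w ^ b * w) * htw
    · rw [Polynomial.coeff_sub, c₀, c₁, show b + 1 + k = b + k + 1 by ring, C_succ]
      push_cast
      ring_nf

theorem exists_aeval_odd {t w z : A} (htw : t * w = 1) (hz : z = 1 - t) (a b : ℕ) :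
    ∃ p : ℚ[X], (-z) ^ a * t ^ b - z ^ a * w ^ (a + b + 1) = z * w * Polynomial.aeval (z ^ 2 * w) p := by
  have hu : z ^ 2 * w = t + w - 2 := by
    subst hz; linear_combination (t - 2) * htw
  induction a generalizing b with
  | zero =>
    induction b using Nat.twoStepInduction with
    | zero =>
      refine ⟨-1, ?_⟩
      simp only [map_neg, map_one]
      subst hz
      linear_combination -htw
    | one =>
      refine ⟨-(3 + Polynomial.X), ?_⟩
      simp only [map_add, map_neg, map_ofNat, Polynomial.aeval_X, hu]
      have hzw : z * w = w - 1 := by subst hz; linear_combination -htw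
      rw [hzw]
      linear_combination htw
    | more b ih₀ ih₁ =>
      obtain ⟨p₀, h₀⟩ := ih₀
      obtain ⟨p₁, h₁⟩ := ih₁
      refine ⟨(2 + Polynomial.X) * p₁ - p₀, ?_⟩
      simp only [map_add, map_sub, map_mul, map_ofNat, Polynomial.aeval_X]
      rw [mul_sub, mul_left_comm, ← h₀, ← h₁, hu]
      simp only [zero_add, pow_zero, one_mul, pow_succ]
      linear_combination (t ^ b - w ^ b * w) * (-htw)
  | succ a ih =>
    obtain ⟨p₀, h₀⟩ := ih b
    obtain ⟨p₁, h₁⟩ := ih (b + 1)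
    refine ⟨p₁ - p₀, ?_⟩
    rw [map_sub, mul_sub, ← h₀, ← h₁]
    have e : a + 1 + b + 1 = a + b + 1 + 1 := by ring
    rw [e, ← add_assoc a b 1]
    subst hz
    simp only [pow_succ]
    linear_combination ((1 - t) ^ a * w ^ a * w ^ b * w) * htw

end Expansion

/-! ### The determinant of cyclically symmetric tilings in a reflection-adapted basis -/

section Tilings

open scoped Polynomial PowerSeries

/-- The power series `1 / (1 - X)`. -/
noncomputable def geomSeries : ℚ⟦X⟧ := PowerSeries.mk 1

theorem one_sub_X_mul_geomSeries : (1 - PowerSeries.X) * geomSeries = 1 := by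
  rw [mul_comm]
  exact PowerSeries.mk_one_mul_one_sub_eq_one ℚ

theorem constantCoeff_geomSeries : PowerSeries.constantCoeff geomSeries = 1 := by
  simp [geomSeries, ← PowerSeries.coeff_zero_eq_constantCoeff_apply]

/-- The power series `(1 - X) ^ x * p(X) + (1 - X) ^ (-x - 1) * p(1 / (1 - X))`. -/
noncomputable def cyclicSeries (x : ℕ) (p : ℚ[X]) : ℚ⟦X⟧ :=
  (1 - PowerSeries.X) ^ x * Polynomial.aeval (PowerSeries.X : ℚ⟦X⟧) p +
    geomSeries ^ (x + 1) * Polynomial.aeval geomSeries p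

theorem cyclicSeries_eq_sum (x : ℕ) {p : ℚ[X]} {m : ℕ} (hp : p.natDegree < m) :
    cyclicSeries x p = ∑ l ∈ range m, p.coeff l • cyclicSeries x (Polynomial.X ^ l) := by
  simp only [cyclicSeries, Polynomial.aeval_eq_sum_range' hp, smul_add, sum_add_distrib, mul_sum,
    mul_smul_comm, map_pow, Polynomial.aeval_X]

theorem Z_eq_det_cyclicSeries (m x : ℕ) :
    Z m (2 * x) = Matrix.det (Matrix.of fun i j : Fin m =>
      PowerSeries.coeff (i : ℕ) (cyclicSeries x (Polynomial.X ^ (j : ℕ)))) := by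
  symm
  rw [det_eq_prod_mul_det_of_lower (m := m)
    (A := fun i j => PowerSeries.coeff i (cyclicSeries x (Polynomial.X ^ j)))
    (L := fun i k => if k ≤ i then
      PowerSeries.coeff (i - k) ((1 - PowerSeries.X : ℚ⟦X⟧) ^ x) else 0)
    (N := fun i j => (if i = j then (1 : ℚ) else 0) + C (2 * x + i + j) (i : ℤ))]
  · simp only [le_refl, if_true, Nat.sub_self, PowerSeries.coeff_zero_eq_constantCoeff_apply,
      map_pow, map_sub, map_one, PowerSeries.constantCoeff_X, sub_zero, one_pow, prod_const_one,
      one_mul]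
    simp only [Z, Fin.ext_iff]
    rfl
  · intro i k hik
    simp [hik.not_ge]
  · intro i hi j _
    have hf : cyclicSeries x (Polynomial.X ^ j) = (1 - PowerSeries.X) ^ x *
        (PowerSeries.X ^ j + geomSeries ^ (2 * x + j + 1)) := by
      have h : (1 - PowerSeries.X) ^ x * geomSeries ^ x = 1 := by
        rw [← mul_pow, one_sub_X_mul_geomSeries, one_pow]
      simp only [cyclicSeries, map_pow, Polynomial.aeval_X]
      linear_combination (-geomSeries ^ (x + 1 + j)) * h
    have hc (k : ℕ) : PowerSeries.coeff k
        (PowerSeries.X ^ j + geomSeries ^ (2 * x + j + 1)) =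
        (if k = j then (1 : ℚ) else 0) + C (2 * x + k + j) (k : ℤ) := by
      rw [map_add, PowerSeries.coeff_X_pow, geomSeries, PowerSeries.mk_one_pow_eq_mk_choose_add,
        PowerSeries.coeff_mk]
      simp only [C, Int.natCast_nonneg, if_true, Int.toNat_natCast]
      rw [show 2 * x + k + j = 2 * x + j + k by ring, Nat.choose_symm_add]
    rw [hf, mul_comm, PowerSeries.coeff_mul,
      Finset.Nat.sum_antidiagonal_eq_sum_range_succ
        (fun a b => PowerSeries.coeff a _ * PowerSeries.coeff b _)]
    simp only [hc, ite_mul, zero_mul]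
    rw [← sum_filter]
    refine sum_congr ?_ fun k _ => mul_comm _ _
    ext k
    simp only [mem_range, mem_filter]
    omega

/-- A monic polynomial of degree `j`, even or odd under `X ↦ 1 - X` according to the parity
of `j`. -/
noncomputable def reflPoly (j : ℕ) : ℚ[X] :=
  (Polynomial.X - Polynomial.C (1 / 2)) ^ (j % 2) *
    (Polynomial.X * (Polynomial.X - Polynomial.C 1)) ^ (j / 2)

theorem reflPoly_monic (j : ℕ) : (reflPoly j).Monic :=
  ((Polynomial.monic_X_sub_C _).pow _).mul
    ((Polynomial.monic_X.mul (Polynomial.monic_X_sub_C _)).pow _)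

theorem natDegree_reflPoly (j : ℕ) : (reflPoly j).natDegree = j := by
  rw [reflPoly, Polynomial.Monic.natDegree_mul ((Polynomial.monic_X_sub_C _).pow _)
    ((Polynomial.monic_X.mul (Polynomial.monic_X_sub_C _)).pow _),
    (Polynomial.monic_X_sub_C _).natDegree_pow,
    (Polynomial.monic_X.mul (Polynomial.monic_X_sub_C _)).natDegree_pow,
    Polynomial.monic_X.natDegree_mul (Polynomial.monic_X_sub_C _)]
  simp only [Polynomial.natDegree_X_sub_C, Polynomial.natDegree_X]
  omega

theorem det_cyclicSeries_reflPoly (m x : ℕ) :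
    Matrix.det (Matrix.of fun i j : Fin m =>
      PowerSeries.coeff (i : ℕ) (cyclicSeries x (reflPoly j))) = Z m (2 * x) := by
  rw [Z_eq_det_cyclicSeries, det_eq_det_mul_prod_of_upper (m := m)
    (A := fun i j => PowerSeries.coeff i (cyclicSeries x (reflPoly j)))
    (N := fun i j => PowerSeries.coeff i (cyclicSeries x (Polynomial.X ^ j)))
    (U := fun k j => (reflPoly j).coeff k)]
  · rw [prod_congr rfl (g := fun _ => 1), prod_const_one, one_mul]
    intro j _
    have := reflPoly_monic j
    rwa [Polynomial.Monic, Polynomial.leadingCoeff, natDegree_reflPoly] at this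
  · intro k j hjk
    exact Polynomial.coeff_eq_zero_of_natDegree_lt (by rwa [natDegree_reflPoly])
  · intro i _ j hj
    rw [cyclicSeries_eq_sum x (m := m) (by rwa [natDegree_reflPoly]), map_sum]
    exact sum_congr rfl fun l _ => by rw [PowerSeries.coeff_smul, smul_eq_mul, mul_comm]

/-- The basis of power series that are even or odd, up to the factor `(1 - X) ^ (1 / 2)`, under the
involution `X ↦ X / (X - 1)`. -/
noncomputable def reflSeries (k : ℕ) : ℚ⟦X⟧ :=
  (if k % 2 = 0 then 1 + geomSeries else PowerSeries.X * geomSeries) *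
    (PowerSeries.X ^ 2 * geomSeries) ^ (k / 2)

theorem exists_reflSeries_eq (k : ℕ) : ∃ g : ℚ⟦X⟧, reflSeries k = PowerSeries.X ^ k * g ∧
    PowerSeries.constantCoeff g = if k % 2 = 0 then 2 else 1 := by
  have hk := Nat.mod_add_div k 2
  obtain h | h := Nat.mod_two_eq_zero_or_one k
  · refine ⟨(1 + geomSeries) * geomSeries ^ (k / 2), ?_, ?_⟩
    · rw [h, zero_add] at hk
      conv_rhs => rw [← hk]
      rw [reflSeries, if_pos h, pow_mul]
      rw [hk]
      ring
    · simp only [map_mul, map_add, map_one, map_pow, constantCoeff_geomSeries, h]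
      norm_num
  · refine ⟨geomSeries * geomSeries ^ (k / 2), ?_, ?_⟩
    · rw [h] at hk
      conv_rhs => rw [← hk]
      rw [reflSeries, if_neg (by omega), pow_add, pow_mul]
      rw [hk]
      ring
    · simp [constantCoeff_geomSeries, h]

theorem coeff_reflSeries_of_lt {i k : ℕ} (h : i < k) :
    PowerSeries.coeff i (reflSeries k) = 0 := by
  obtain ⟨g, hg, -⟩ := exists_reflSeries_eq k
  rw [hg, PowerSeries.coeff_X_pow_mul', if_neg h.not_ge]

theorem coeff_reflSeries_self (k : ℕ) :
    PowerSeries.coeff k (reflSeries k) = if k % 2 = 0 then 2 else 1 := by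
  obtain ⟨g, hg, hc⟩ := exists_reflSeries_eq k
  rw [hg, PowerSeries.coeff_X_pow_mul', if_pos le_rfl, Nat.sub_self,
    PowerSeries.coeff_zero_eq_constantCoeff_apply, hc]

theorem coeff_mul_aeval_eq_sum {r : ℕ} (hr : r < 2) (p : ℚ[X]) {i m : ℕ} (hi : i < m) :
    PowerSeries.coeff i ((if r = 0 then 1 + geomSeries else PowerSeries.X * geomSeries) *
      Polynomial.aeval (PowerSeries.X ^ 2 * geomSeries) p) =
      ∑ k ∈ range m, PowerSeries.coeff i (reflSeries (2 * k + r)) * p.coeff k := by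
  have hn : p.natDegree < max m (p.natDegree + 1) := by omega
  rw [Polynomial.aeval_eq_sum_range' hn, mul_sum, map_sum]
  have hs : range m ⊆ range (max m (p.natDegree + 1)) :=
    range_subset_range.2 (le_max_left _ _)
  rw [sum_subset hs (f := fun k => PowerSeries.coeff i (reflSeries (2 * k + r)) * p.coeff k)]
  · refine sum_congr rfl fun k _ => ?_
    have h₁ : (2 * k + r) % 2 = r := by omega
    have h₂ : (2 * k + r) / 2 = k := by omega
    rw [mul_smul_comm, PowerSeries.coeff_smul, smul_eq_mul, mul_comm, reflSeries, h₁, h₂]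
  · intro k _ hk
    rw [coeff_reflSeries_of_lt (by simp at hk; omega), zero_mul]

theorem prod_coeff_reflSeries {a b : ℕ} (hba : b ≤ a) (hab : a ≤ b + 1) :
    ∏ k ∈ range (a + b), PowerSeries.coeff k (reflSeries k) = 2 ^ a := by
  have h (n : ℕ) : ∏ k ∈ range (2 * n), PowerSeries.coeff k (reflSeries k) = 2 ^ n := by
    induction n with
    | zero => simp
    | succ n ih =>
      rw [Nat.mul_succ, prod_range_succ, prod_range_succ, ih, coeff_reflSeries_self,
        coeff_reflSeries_self, if_pos (by omega), if_neg (by omega), pow_succ, mul_one]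
  obtain rfl | rfl : a = b ∨ a = b + 1 := by omega
  · rw [← two_mul, h]
  · rw [show b + 1 + b = 2 * b + 1 by ring, prod_range_succ, h, coeff_reflSeries_self,
      if_pos (by omega), pow_succ]

theorem exists_cyclicSeries_even (x l : ℕ) :
    ∃ p : ℚ[X], cyclicSeries x (reflPoly (2 * l)) =
        (1 + geomSeries) * Polynomial.aeval (PowerSeries.X ^ 2 * geomSeries) p ∧
      ∀ k : ℕ, p.coeff k = C (x + l + k) (2 * k - l) := by
  obtain ⟨p, hp, hc⟩ := exists_aeval_even (w := geomSeries) (z := PowerSeries.X)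
    one_sub_X_mul_geomSeries (sub_sub_cancel _ _).symm l (x + l)
  refine ⟨p, ?_, hc⟩
  rw [← hp, reflPoly, show 2 * l % 2 = 0 by omega, show 2 * l / 2 = l by omega]
  have h : geomSeries * (geomSeries - 1) = PowerSeries.X * geomSeries ^ 2 := by
    linear_combination geomSeries * one_sub_X_mul_geomSeries
  simp only [cyclicSeries, map_mul, map_pow, map_sub, Polynomial.aeval_X, map_one, pow_zero,
    one_mul, h]
  have h' : PowerSeries.X * (PowerSeries.X - 1) =
    (-PowerSeries.X) * (1 - PowerSeries.X : ℚ⟦X⟧) := by ring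
  rw [h', mul_pow, mul_pow, ← pow_mul]
  ring

theorem exists_cyclicSeries_odd (x l : ℕ) :
    ∃ p : ℚ[X], cyclicSeries x (reflPoly (2 * l + 1)) = PowerSeries.X * geomSeries *
      Polynomial.aeval (PowerSeries.X ^ 2 * geomSeries) p := by
  obtain ⟨p₀, hp₀⟩ := exists_aeval_odd (w := geomSeries) (z := PowerSeries.X)
    one_sub_X_mul_geomSeries (sub_sub_cancel _ _).symm l (x + l)
  obtain ⟨p₁, hp₁⟩ := exists_aeval_odd (w := geomSeries) (z := PowerSeries.X)
    one_sub_X_mul_geomSeries (sub_sub_cancel _ _).symm (l + 1) (x + l)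
  refine ⟨-p₁ - (1 / 2 : ℚ) • p₀, ?_⟩
  rw [map_sub, map_neg, map_smul, mul_sub, mul_neg, mul_smul_comm, ← hp₀, ← hp₁, reflPoly,
    show (2 * l + 1) % 2 = 1 by omega, show (2 * l + 1) / 2 = l by omega]
  have h : geomSeries * (geomSeries - 1) = PowerSeries.X * geomSeries ^ 2 := by
    linear_combination geomSeries * one_sub_X_mul_geomSeries
  simp only [cyclicSeries, map_mul, map_pow, map_sub, Polynomial.aeval_X, map_one, pow_one,
    h, Polynomial.aeval_C, Algebra.smul_def]
  have h' : PowerSeries.X * (PowerSeries.X - 1) =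
    (-PowerSeries.X) * (1 - PowerSeries.X : ℚ⟦X⟧) := by ring
  rw [h', mul_pow, mul_pow, ← pow_mul]
  set c := algebraMap ℚ ℚ⟦X⟧ (1 / 2) with hc
  have hc1 : 2 * c = 1 := by
    rw [hc, ← map_ofNat (algebraMap ℚ ℚ⟦X⟧) 2, ← map_mul]
    norm_num
  have e : l + 1 + (x + l) + 1 = 2 * l + x + 2 := by ring
  have e' : l + (x + l) + 1 = 2 * l + x + 1 := by ring
  rw [e, e']
  simp only [pow_succ, pow_add]
  linear_combination (geomSeries ^ x * geomSeries * geomSeries ^ (2 * l) * PowerSeries.X ^ l) *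
    (one_sub_X_mul_geomSeries - hc1)

/-- The determinant for cyclically symmetric tilings is, up to a power of two, the determinant for
cyclically symmetric transposed-complementary tilings times a factor depending only on half the
order, rounded down. -/
theorem exists_Z_eq_T_mul (x : ℕ) :
    ∃ O : ℕ → ℚ, ∀ a b, b ≤ a → a ≤ b + 1 → Z (a + b) (2 * x) = 2 ^ a * T a x * O b := by
  choose p hp hpc using exists_cyclicSeries_even x
  choose q hq using exists_cyclicSeries_odd x
  refine ⟨fun b => Matrix.det (Matrix.of fun i j : Fin b => (q j).coeff i),
    fun a b hba hab => ?_⟩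
  let N : ℕ → ℕ → ℚ := fun k j => if k % 2 = j % 2 then
    (if j % 2 = 0 then (p (j / 2)).coeff (k / 2) else (q (j / 2)).coeff (k / 2)) else 0
  have hN₀ (k j : ℕ) : N (2 * k) (2 * j) = (p j).coeff k := by simp [N]
  have hN₁ (k j : ℕ) : N (2 * k + 1) (2 * j + 1) = (q j).coeff k := by
    simp [N, Nat.add_mod, show (2 * k + 1) / 2 = k by omega, show (2 * j + 1) / 2 = j by omega]
  have hN₂ (k j : ℕ) : N (2 * k) (2 * j + 1) = 0 := by simp [N, Nat.add_mod]
  have hN₃ (k j : ℕ) : N (2 * k + 1) (2 * j) = 0 := by simp [N, Nat.add_mod]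
  rw [← det_cyclicSeries_reflPoly, det_eq_prod_mul_det_of_lower (m := a + b)
    (A := fun i j => PowerSeries.coeff i (cyclicSeries x (reflPoly j)))
    (L := fun i k => PowerSeries.coeff i (reflSeries k)) (N := N)
    (fun i k hik => coeff_reflSeries_of_lt hik), prod_coeff_reflSeries hba hab,
    det_checkerboard rfl hba hab N hN₂ hN₃, mul_assoc]
  · congr 2
    · rw [← Matrix.det_transpose, T]
      congr 1
      ext i j
      simp [hN₀, hpc]
    · simp only [hN₁]
  · intro i hi j _
    have hext : ∑ k ∈ range (a + b), PowerSeries.coeff i (reflSeries k) * N k j =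
        ∑ k ∈ range (2 * (a + b)), PowerSeries.coeff i (reflSeries k) * N k j := by
      refine sum_subset (range_subset_range.2 (by omega)) fun k _ hk => ?_
      rw [coeff_reflSeries_of_lt (by simp at hk; omega), zero_mul]
    rw [hext, sum_range_two_mul]
    obtain ⟨l, rfl | rfl⟩ := j.even_or_odd'
    · rw [hp]
      simp only [hN₀, hN₃, mul_zero, add_zero]
      simpa using coeff_mul_aeval_eq_sum (r := 0) (by norm_num) (p l) hi
    · rw [hq]
      simp only [hN₁, hN₂, mul_zero, zero_add]
      simpa using coeff_mul_aeval_eq_sum (r := 1) (by norm_num) (q l) hi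

end Tilings

theorem CSTC_ratio (n x : ℕ) :
    2 * T (n + 1) x * Z (2 * n) (2 * x) = T n x * Z (2 * n + 1) (2 * x) := by
  obtain ⟨O, hO⟩ := exists_Z_eq_T_mul x
  have h₀ := hO n n le_rfl (by omega)
  have h₁ := hO (n + 1) n (by omega) le_rfl
  rw [← two_mul] at h₀
  rw [show n + 1 + n = 2 * n + 1 by ring] at h₁
  rw [h₀, h₁]
  ring
end

section
/- For all nonnegative integers n and x, 2^n · T_n(x) · ∏_{k=0}^{n-1} Z_{2k}(2x) = ∏_{k=0}^{n-1} Z_{2k+1}(2x); equivalently, T_n(x) = 2^{-n} · ∏_{k=0}^{n-1} [ Z_{2k+1}(2x) / Z_{2k}(2x) ]. -/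
open Finset

namespace CyclicPlanePartitions

section Fibonacci

variable {A : Type*} [CommRing A]

/-- The bivariate Fibonacci polynomials `∑ C(n-k, k) s^(n-2k) p^k`, which satisfy
`fibSum (n+2) = s fibSum (n+1) + p fibSum n`. -/
def fibSum (s p : A) (n : ℕ) : A :=
  ∑ q ∈ antidiagonal n, (q.1.choose q.2 : A) * s ^ (q.1 - q.2) * p ^ q.2

lemma fibSum_zero (s p : A) : fibSum s p 0 = 1 := by simp [fibSum]

lemma fibSum_one (s p : A) : fibSum s p 1 = s := by
  simp [fibSum, Finset.Nat.antidiagonal_succ]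

lemma fibSum_add_two (s p : A) (n : ℕ) :
    fibSum s p (n + 2) = s * fibSum s p (n + 1) + p * fibSum s p n := by
  unfold fibSum
  rw [Finset.Nat.sum_antidiagonal_succ', Finset.Nat.sum_antidiagonal_succ,
    Finset.Nat.sum_antidiagonal_succ', mul_add, Finset.mul_sum, Finset.mul_sum]
  have key : ∀ q : ℕ × ℕ,
      ((q.1 + 1).choose (q.2 + 1) : A) * s ^ (q.1 + 1 - (q.2 + 1)) * p ^ (q.2 + 1) =
        s * ((q.1.choose (q.2 + 1) : A) * s ^ (q.1 - (q.2 + 1)) * p ^ (q.2 + 1)) +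
          p * ((q.1.choose q.2 : A) * s ^ (q.1 - q.2) * p ^ q.2) := by
    rintro ⟨a, k⟩
    simp only [Nat.choose_succ_succ, Nat.add_sub_add_right, Nat.cast_add]
    rcases Nat.lt_or_ge k a with h | h
    · obtain ⟨d, rfl⟩ := Nat.exists_eq_add_of_lt h
      rw [show k + d + 1 - k = d + 1 by lia, show k + d + 1 - (k + 1) = d by lia]
      ring
    · rw [Nat.choose_eq_zero_of_lt (show a < k + 1 by lia)]
      push_cast
      ring
  simp only [key, Finset.sum_add_distrib]
  simp
  ring

lemma one_sub_mul_fibSum (b : A) (n : ℕ) :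
    (1 - b) * fibSum (1 + b) (-b) n = 1 - b ^ (n + 1) := by
  induction n using Nat.twoStepInduction with
  | zero => rw [fibSum_zero]; ring
  | one => rw [fibSum_one]; ring
  | more n h₀ h₁ =>
    rw [fibSum_add_two]
    linear_combination (1 + b) * h₁ - b * h₀

lemma two_mul_fibSum_add (b : A) (n : ℕ) :
    2 * fibSum (1 + b) (-b) (n + 3) + (1 + b) * (-b) * fibSum (1 + b) (-b) n =
      (1 + 2 * b) * b ^ (n + 2) + (2 + b) := by
  induction n using Nat.twoStepInduction with
  | zero => simp only [fibSum_add_two, zero_add, fibSum_one, fibSum_zero]; ring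
  | one => simp only [fibSum_add_two, Nat.reduceAdd, zero_add, fibSum_one, fibSum_zero]; ring
  | more n h₀ h₁ =>
    rw [fibSum_add_two _ _ (n + 3), fibSum_add_two _ _ n]
    linear_combination (1 + b) * h₁ - b * h₀

end Fibonacci

section Series

open PowerSeries hiding C

/-- The power series `1 / (1 - X)`. -/
noncomputable def geom : ℚ⟦X⟧ := PowerSeries.mk 1

lemma geom_mul : geom * (1 - X) = 1 := PowerSeries.mk_one_mul_one_sub_eq_one ℚ

lemma constantCoeff_geom : constantCoeff geom = 1 := by
  simp [geom]

lemma coeff_geom_pow (d i : ℕ) : coeff i (geom ^ (d + 1)) = ((d + i).choose d : ℚ) := by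
  rw [geom, PowerSeries.mk_one_pow_eq_mk_choose_add, coeff_mk]

lemma C_natCast (m k : ℕ) : C m (k : ℤ) = (m.choose k : ℚ) := by simp [C]

lemma C_of_neg (m : ℕ) {k : ℤ} (h : k < 0) : C m k = 0 := by
  simp [C, h]

lemma C_of_lt {m : ℕ} {k : ℤ} (h : (m : ℤ) < k) : C m k = 0 := by
  obtain ⟨l, rfl⟩ := Int.eq_ofNat_of_zero_le (show 0 ≤ k by lia)
  rw [C_natCast, Nat.choose_eq_zero_of_lt (by lia), Nat.cast_zero]

/-- A suitably normalised `fibSum X (1 - X) n` is a polynomial in `X ^ 2 / (1 - X)`. -/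
lemma fibSum_eq_sum_C {n c a d e K : ℕ} (hn : n = a + c) (he : e + n = 2 * c + d) (hd : d ≤ 1)
    (hK : c < K) :
    X ^ e * geom ^ c * fibSum (X : ℚ⟦X⟧) (1 - X) n =
      X ^ d * ∑ i ∈ range K, algebraMap ℚ ℚ⟦X⟧ (C (a + i) (a - c + 2 * i)) *
        (X ^ 2 * geom) ^ i := by
  have hR : ∑ i ∈ range K, algebraMap ℚ ℚ⟦X⟧ (C (a + i) (a - c + 2 * i)) * (X ^ 2 * geom) ^ i =
      ∑ i ∈ range (c + 1),
        algebraMap ℚ ℚ⟦X⟧ (C (a + i) (a - c + 2 * i)) * (X ^ 2 * geom) ^ i := by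
    symm
    refine Finset.sum_subset (by intro i; simp; lia) fun i _ hi => ?_
    rw [C_of_lt (by simp at hi; lia), map_zero, zero_mul]
  have hL : fibSum (X : ℚ⟦X⟧) (1 - X) n =
      ∑ k ∈ range (c + 1), ((n - k).choose k : ℚ⟦X⟧) * X ^ (n - k - k) * (1 - X) ^ k := by
    rw [fibSum, Finset.Nat.sum_antidiagonal_eq_sum_range_succ_mk]
    rw [← Finset.sum_range_reflect]
    symm
    refine Finset.sum_subset_zero_on_sdiff (by intro i; simp; lia) (fun k hk => ?_) (fun k hk => ?_)
    · simp only [mem_sdiff, mem_range] at hk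
      rw [Nat.choose_eq_zero_of_lt (by lia), Nat.cast_zero, zero_mul, zero_mul]
    · simp only [mem_range] at hk
      rw [show n.succ - 1 - k = n - k by lia, show n - (n - k) = k by lia]
  rw [hR, hL, ← Finset.sum_range_reflect, Finset.mul_sum, Finset.mul_sum]
  refine Finset.sum_congr rfl fun i hi => ?_
  simp only [mem_range] at hi
  obtain ⟨k, rfl⟩ : ∃ k, c = i + k := ⟨c - i, by lia⟩
  rw [show i + k + 1 - 1 - i = k by lia]
  rcases Nat.lt_or_ge (n - k) k with h | h
  · rw [Nat.choose_eq_zero_of_lt h, C_of_neg _ (by lia)]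
    simp
  · have h1 : C (a + i) (a - (i + k : ℕ) + 2 * i) = ((n - k).choose k : ℚ) := by
      rw [show ((a : ℤ) - (i + k : ℕ) + 2 * i) = ((n - k - k : ℕ) : ℤ) by lia, C_natCast,
        show a + i = n - k by lia, Nat.choose_symm h]
    have h2 : geom ^ (i + k) * (1 - X) ^ k = geom ^ i := by
      rw [pow_add, mul_assoc, ← mul_pow, geom_mul, one_pow, mul_one]
    have h3 : (X : ℚ⟦X⟧) ^ e * X ^ (n - k - k) = X ^ d * X ^ (2 * i) := by
      rw [← pow_add, ← pow_add]
      congr 1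
      lia
    rw [h1, map_natCast, mul_pow, ← pow_mul]
    linear_combination (X ^ e * X ^ (n - k - k) * ((n - k).choose k : ℚ⟦X⟧)) * h2 +
      (geom ^ i * ((n - k).choose k : ℚ⟦X⟧)) * h3

lemma geom_mul_X_sub_one_pow (m : ℕ) : geom ^ m * (X - 1) ^ m = (-1) ^ m := by
  rw [← mul_pow]
  congr 1
  linear_combination -geom_mul

lemma even_series {x j K : ℕ} (hK : x + 2 * j < K) :
    (X * (X - 1)) ^ j + geom ^ (2 * x + 1) * (geom * (geom - 1)) ^ j =
      (2 - X) * geom ^ (x + 1) * ∑ i ∈ range K,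
        algebraMap ℚ ℚ⟦X⟧ (C (x + i + j) (2 * i - j)) * (X ^ 2 * geom) ^ i := by
  have h := fibSum_eq_sum_C (n := 2 * x + 3 * j) (c := x + 2 * j) (a := x + j) (d := 0) (e := j)
    (K := K) (by ring) (by ring) (by simp) hK
  have h1 := one_sub_mul_fibSum (X - 1 : ℚ⟦X⟧) (2 * x + 3 * j)
  rw [show (1 : ℚ⟦X⟧) + (X - 1) = X by ring, show -(X - 1 : ℚ⟦X⟧) = 1 - X by ring] at h1
  have h2 := geom_mul_X_sub_one_pow (2 * x + 2 * j + 1)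
  rw [Odd.neg_one_pow ⟨x + j, by ring⟩] at h2
  have h3 : geom * (geom - 1) = X * geom ^ 2 := by
    linear_combination geom * geom_mul
  have h4 : ∑ i ∈ range K, algebraMap ℚ ℚ⟦X⟧ (C (x + i + j) (2 * i - j)) * (X ^ 2 * geom) ^ i =
      X ^ j * geom ^ (x + 2 * j) * fibSum X (1 - X) (2 * x + 3 * j) := by
    rw [h, pow_zero, one_mul]
    refine Finset.sum_congr rfl fun i _ => ?_
    congr 3 <;> push_cast <;> ring
  rw [h3, h4, mul_pow, mul_pow]
  linear_combination (-(X ^ j * geom ^ (2 * x + 2 * j + 1))) * h1 + (X ^ j * (X - 1) ^ j) * h2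

lemma odd_series {x j K : ℕ} (hK : x + 2 * j + 1 < K) :
    (2 * X - 1) * (X * (X - 1)) ^ j +
        geom ^ (2 * x + 1) * ((2 * geom - 1) * (geom * (geom - 1)) ^ j) =
      X * geom ^ (x + 1) * ∑ i ∈ range K,
        algebraMap ℚ ℚ⟦X⟧ (C (x + i + j) (2 * i - j) + 2 * C (x + i + j + 2) (2 * i - j + 1)) *
          (X ^ 2 * geom) ^ i := by
  have h := fibSum_eq_sum_C (n := 2 * x + 3 * j) (c := x + 2 * j) (a := x + j) (d := 0) (e := j)
    (K := K) (by ring) (by ring) (by simp) (by lia)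
  have h' := fibSum_eq_sum_C (n := 2 * x + 3 * j + 3) (c := x + 2 * j + 1) (a := x + j + 2)
    (d := 1) (e := j) (K := K) (by ring) (by ring) (by simp) hK
  have h1 := two_mul_fibSum_add (X - 1 : ℚ⟦X⟧) (2 * x + 3 * j)
  rw [show (1 : ℚ⟦X⟧) + (X - 1) = X by ring, show -(X - 1 : ℚ⟦X⟧) = 1 - X by ring] at h1
  have h2 := geom_mul_X_sub_one_pow (2 * x + 2 * j + 2)
  rw [Even.neg_one_pow ⟨x + j + 1, by ring⟩] at h2
  have h3 : geom * (geom - 1) = X * geom ^ 2 := by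
    linear_combination geom * geom_mul
  have h5 : 2 * geom - 1 = (1 + X) * geom := by linear_combination geom_mul
  have h4 : X * ∑ i ∈ range K,
        algebraMap ℚ ℚ⟦X⟧ (C (x + i + j) (2 * i - j) + 2 * C (x + i + j + 2) (2 * i - j + 1)) *
          (X ^ 2 * geom) ^ i =
      X * (X ^ j * geom ^ (x + 2 * j) * fibSum X (1 - X) (2 * x + 3 * j)) +
        2 * (X ^ j * geom ^ (x + 2 * j + 1) * fibSum X (1 - X) (2 * x + 3 * j + 3)) := by
    rw [h, h', pow_zero, one_mul, pow_one, mul_left_comm, ← mul_add]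
    congr 1
    rw [Finset.mul_sum, ← Finset.sum_add_distrib]
    refine Finset.sum_congr rfl fun i _ => ?_
    have e₁ : C (x + j + i) ((x + j : ℕ) - (x + 2 * j : ℕ) + 2 * i) = C (x + i + j) (2 * i - j) := by
      congr 1 <;> push_cast <;> ring
    have e₂ : C (x + j + 2 + i) ((x + j + 2 : ℕ) - (x + 2 * j + 1 : ℕ) + 2 * i) =
        C (x + i + j + 2) (2 * i - j + 1) := by
      congr 1 <;> push_cast <;> ring
    rw [e₁, e₂, map_add, map_mul, map_ofNat]
    ring
  rw [h3, h5, mul_pow, mul_pow]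
  linear_combination (-geom ^ (x + 1)) * h4 - (geom ^ (2 * x + 2 * j + 2) * X ^ j) * h1 -
    ((2 * X - 1) * X ^ j * (X - 1) ^ j) * h2 +
    (X * X ^ j * fibSum X (1 - X) (2 * x + 3 * j) * geom ^ (2 * x + 2 * j + 1)) * geom_mul

lemma sum_range_two_mul {M : Type*} [AddCommMonoid M] (f : ℕ → M) (K : ℕ) :
    ∑ l ∈ range (2 * K), f l = ∑ i ∈ range K, (f (2 * i) + f (2 * i + 1)) := by
  induction K with
  | zero => simp
  | succ K ih => rw [mul_add_one, Finset.sum_range_succ, Finset.sum_range_succ, ih,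
      Finset.sum_range_succ, add_assoc]

/-- The monic polynomials `(X (X - 1)) ^ j` and `(X - 1 / 2) (X (X - 1)) ^ j`, which are the
symmetric and the antisymmetric ones under `X ↦ 1 - X`. -/
noncomputable def reflPoly (k : ℕ) : Polynomial ℚ :=
  (Polynomial.X - Polynomial.C (1 / 2)) ^ (k % 2) *
    (Polynomial.X * (Polynomial.X - Polynomial.C 1)) ^ (k / 2)

lemma monic_reflPoly (k : ℕ) : (reflPoly k).Monic :=
  ((Polynomial.monic_X_sub_C _).pow _).mul
    ((Polynomial.monic_X.mul (Polynomial.monic_X_sub_C _)).pow _)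

lemma natDegree_reflPoly (k : ℕ) : (reflPoly k).natDegree = k := by
  rw [reflPoly, Polynomial.Monic.natDegree_mul ((Polynomial.monic_X_sub_C _).pow _)
    ((Polynomial.monic_X.mul (Polynomial.monic_X_sub_C _)).pow _),
    (Polynomial.monic_X_sub_C _).natDegree_pow,
    (Polynomial.monic_X.mul (Polynomial.monic_X_sub_C _)).natDegree_pow,
    Polynomial.monic_X.natDegree_mul (Polynomial.monic_X_sub_C _),
    Polynomial.natDegree_X_sub_C, Polynomial.natDegree_X_sub_C, Polynomial.natDegree_X]
  lia

/-- A family of power series of orders `0, 1, 2, …` which are alternately symmetric and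
antisymmetric under `f ↦ (1 - X) ^ (-2 x - 1) f (X / (X - 1))`. -/
noncomputable def reflSeries (x l : ℕ) : ℚ⟦X⟧ :=
  X ^ l * (if l % 2 = 0 then (1 - PowerSeries.C (1 / 2) * X) * geom ^ (x + 1 + l / 2)
    else geom ^ (x + 1 + l / 2))

/-- The matrix of the operator `1 + B`, where `B` is the operator
`f ↦ (1 - X) ^ (-2 x - 1) f (1 / (1 - X))`, from `reflPoly` to `reflSeries`. -/
def reflMatrix (x l j : ℕ) : ℚ :=
  if l % 2 = 0 then
    if j % 2 = 0 then 2 * C (x + l / 2 + j / 2) (2 * (l / 2 : ℕ) - (j / 2 : ℕ)) else 0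
  else
    if j % 2 = 0 then 0 else
      1 / 2 * (C (x + l / 2 + j / 2) (2 * (l / 2 : ℕ) - (j / 2 : ℕ)) +
        2 * C (x + l / 2 + j / 2 + 2) (2 * (l / 2 : ℕ) - (j / 2 : ℕ) + 1))

lemma reflPoly_two_mul (j : ℕ) :
    reflPoly (2 * j) = (Polynomial.X * (Polynomial.X - Polynomial.C 1)) ^ j := by
  simp [reflPoly]

lemma reflPoly_two_mul_add_one (j : ℕ) :
    reflPoly (2 * j + 1) = (Polynomial.X - Polynomial.C (1 / 2)) *
      (Polynomial.X * (Polynomial.X - Polynomial.C 1)) ^ j := by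
  rw [reflPoly, Nat.mul_add_mod, Nat.mul_add_div two_pos]
  simp

lemma reflSeries_two_mul (x i : ℕ) :
    reflSeries x (2 * i) =
      (1 - PowerSeries.C (1 / 2) * X) * geom ^ (x + 1) * (X ^ 2 * geom) ^ i := by
  rw [reflSeries, if_pos (Nat.mul_mod_right 2 i), Nat.mul_div_cancel_left i two_pos]
  ring

lemma reflSeries_two_mul_add_one (x i : ℕ) :
    reflSeries x (2 * i + 1) = X * geom ^ (x + 1) * (X ^ 2 * geom) ^ i := by
  rw [reflSeries, if_neg (by lia), Nat.mul_add_div two_pos]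
  ring

lemma reflMatrix_two_mul_two_mul (x i j : ℕ) :
    reflMatrix x (2 * i) (2 * j) = 2 * C (x + i + j) (2 * i - j) := by
  rw [reflMatrix, if_pos (by lia), if_pos (by lia), Nat.mul_div_cancel_left i two_pos,
    Nat.mul_div_cancel_left j two_pos]

lemma reflMatrix_two_mul_two_mul_add_one (x i j : ℕ) :
    reflMatrix x (2 * i) (2 * j + 1) = 0 := by
  rw [reflMatrix, if_pos (by lia), if_neg (by lia)]

lemma reflMatrix_two_mul_add_one_two_mul (x i j : ℕ) :
    reflMatrix x (2 * i + 1) (2 * j) = 0 := by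
  rw [reflMatrix, if_neg (by lia), if_pos (by lia)]

lemma reflMatrix_two_mul_add_one_two_mul_add_one (x i j : ℕ) :
    reflMatrix x (2 * i + 1) (2 * j + 1) =
      1 / 2 * (C (x + i + j) (2 * i - j) + 2 * C (x + i + j + 2) (2 * i - j + 1)) := by
  rw [reflMatrix, if_neg (by lia), if_neg (by lia), Nat.mul_add_div two_pos,
    Nat.mul_add_div two_pos]
  rfl

lemma two_mul_algebraMap_half : 2 * algebraMap ℚ ℚ⟦X⟧ (1 / 2) = 1 := by
  rw [← map_ofNat (algebraMap ℚ ℚ⟦X⟧) 2, ← map_mul]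
  norm_num

lemma reflPoly_add_eq_sum {x j K : ℕ} (hK : x + j + 1 < K) :
    (reflPoly j : ℚ⟦X⟧) + geom ^ (2 * x + 1) * Polynomial.aeval geom (reflPoly j) =
      ∑ l ∈ range (2 * K), algebraMap ℚ ℚ⟦X⟧ (reflMatrix x l j) * reflSeries x l := by
  have half := two_mul_algebraMap_half
  rw [sum_range_two_mul]
  rcases Nat.even_or_odd' j with ⟨j, rfl | rfl⟩
  · have h := even_series (x := x) (j := j) (K := K) (by lia)
    rw [Finset.mul_sum] at h
    simp only [reflPoly_two_mul, reflMatrix_two_mul_two_mul, reflMatrix_two_mul_add_one_two_mul,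
      map_pow, map_mul, map_sub, Polynomial.aeval_X, Polynomial.coe_pow, Polynomial.coe_mul,
      Polynomial.coe_sub, Polynomial.coe_X, Polynomial.coe_one, map_one, map_zero, zero_mul,
      add_zero]
    rw [h]
    refine Finset.sum_congr rfl fun i _ => ?_
    rw [reflSeries_two_mul, PowerSeries.C_eq_algebraMap, map_ofNat]
    linear_combination (algebraMap ℚ ℚ⟦X⟧ (C (x + i + j) (2 * i - j)) * X * geom ^ (x + 1) *
      (X ^ 2 * geom) ^ i) * half
  · have h := odd_series (x := x) (j := j) (K := K) (by lia)
    have h' := congr_arg (algebraMap ℚ ℚ⟦X⟧ (1 / 2) * ·) h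
    simp only [Finset.mul_sum] at h'
    simp only [reflPoly_two_mul_add_one, reflMatrix_two_mul_two_mul_add_one,
      reflMatrix_two_mul_add_one_two_mul_add_one,
      map_pow, map_mul (Polynomial.aeval geom), map_sub, Polynomial.aeval_X, Polynomial.aeval_C,
      Polynomial.coe_pow, Polynomial.coe_mul, Polynomial.coe_sub, Polynomial.coe_X,
      Polynomial.coe_C, Polynomial.coe_one, PowerSeries.C_eq_algebraMap, map_one, map_zero, zero_mul, zero_add]
    have hsum : ∀ i, algebraMap ℚ ℚ⟦X⟧
          (1 / 2 * (C (x + i + j) (2 * i - j) + 2 * C (x + i + j + 2) (2 * i - j + 1))) *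
            reflSeries x (2 * i + 1) =
        algebraMap ℚ ℚ⟦X⟧ (1 / 2) * (X * geom ^ (x + 1) * (algebraMap ℚ ℚ⟦X⟧
          (C (x + i + j) (2 * i - j) + 2 * C (x + i + j + 2) (2 * i - j + 1)) *
            (X ^ 2 * geom) ^ i)) := by
      intro i
      rw [reflSeries_two_mul_add_one, map_mul]
      ring
    rw [Finset.sum_congr rfl fun i _ => hsum i]
    linear_combination h' - ((X * (X - 1)) ^ j * X +
      geom ^ (2 * x + 1) * (geom * (geom - 1)) ^ j * geom) * half

lemma coeff_reflSeries_of_lt {x l i : ℕ} (h : i < l) : coeff i (reflSeries x l) = 0 := by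
  rw [reflSeries, coeff_X_pow_mul', if_neg (by lia)]

lemma coeff_reflSeries_self (x l : ℕ) : coeff l (reflSeries x l) = 1 := by
  rw [reflSeries, coeff_X_pow_mul', if_pos le_rfl, Nat.sub_self, coeff_zero_eq_constantCoeff_apply]
  split_ifs <;> simp [constantCoeff_geom]

lemma sum_C_mul_coeff {m : ℕ} (y i : ℕ) {p : Polynomial ℚ} (hp : p.natDegree < m) :
    ∑ k ∈ range m, C (y + i + k) i * p.coeff k =
      coeff i (geom ^ (y + 1) * Polynomial.aeval geom p) := by
  rw [Polynomial.aeval_eq_sum_range' hp, Finset.mul_sum, map_sum]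
  refine Finset.sum_congr rfl fun k _ => ?_
  rw [mul_smul_comm, ← pow_add, show y + 1 + k = y + k + 1 by ring, coeff_smul, coeff_geom_pow,
    C_natCast, smul_eq_mul, mul_comm, ← Nat.choose_symm_of_eq_add (show y + i + k = y + k + i by ring)]
  congr 3
  ring

end Series

section Determinant

lemma Z_eq_det_reflMatrix (m x : ℕ) :
    Z m (2 * x) = Matrix.det (Matrix.of fun l j : Fin m => reflMatrix x l j) := by
  have hF : (Matrix.of fun k j : Fin m => (reflPoly j).coeff k).det = 1 :=
    (Matrix.det_matrixOfPolynomials (fun j : Fin m => reflPoly j)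
      (fun j => natDegree_reflPoly j) (fun j => monic_reflPoly j))
  have hG : (Matrix.of fun i l : Fin m => PowerSeries.coeff i (reflSeries x l)).det = 1 := by
    rw [Matrix.det_of_isLowerTriangular _ fun i j (h : i < j) => by
      rw [Matrix.of_apply, coeff_reflSeries_of_lt h]]
    simp [coeff_reflSeries_self]
  have key : (Matrix.of fun i j : Fin m => (if i = j then (1 : ℚ) else 0) +
      C (2 * x + (i : ℕ) + (j : ℕ)) (i : ℤ)) * (Matrix.of fun k j : Fin m => (reflPoly j).coeff k) =
      (Matrix.of fun i l : Fin m => PowerSeries.coeff i (reflSeries x l)) *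
        (Matrix.of fun l j : Fin m => reflMatrix x l j) := by
    ext i j
    simp only [Matrix.mul_apply, Matrix.of_apply, add_mul, Finset.sum_add_distrib, ite_mul,
      one_mul, zero_mul, Finset.sum_ite_eq, Finset.mem_univ, if_true]
    rw [Fin.sum_univ_eq_sum_range (fun k => C (2 * x + i + k) i * (reflPoly j).coeff k),
      sum_C_mul_coeff _ _ (by rw [natDegree_reflPoly]; exact j.2),
      Fin.sum_univ_eq_sum_range (fun l => PowerSeries.coeff i (reflSeries x l) * reflMatrix x l j),
      ← Polynomial.coeff_coe, ← map_add, reflPoly_add_eq_sum (K := x + m + 1) (by lia), map_sum]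
    symm
    simp only [← Algebra.smul_def, PowerSeries.coeff_smul, smul_eq_mul, mul_comm (reflMatrix _ _ _)]
    refine Finset.sum_subset (by intro i; simp; lia) fun l _ hl => ?_
    rw [coeff_reflSeries_of_lt (by simp at hl; lia), zero_mul]
  have := congr_arg Matrix.det key
  rwa [Matrix.det_mul, Matrix.det_mul, hF, hG, mul_one, one_mul] at this

/-- The equivalence which sends the left summand to the even numbers and the right summand to
the odd numbers. -/
noncomputable def interleave {a b m : ℕ} (ha : a = (m + 1) / 2) (hb : b = m / 2) :
    Fin a ⊕ Fin b ≃ Fin m :=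
  Equiv.ofBijective
    (Sum.elim (fun i => ⟨2 * i, by lia⟩) (fun i => ⟨2 * i + 1, by lia⟩)) <| by
    rw [Fintype.bijective_iff_injective_and_card]
    refine ⟨?_, by simp; lia⟩
    rintro (i | i) (j | j) h <;> simp [Fin.ext_iff] at h ⊢ <;> lia

lemma det_reflMatrix {a b m : ℕ} (ha : a = (m + 1) / 2) (hb : b = m / 2) (x : ℕ) :
    Matrix.det (Matrix.of fun l j : Fin m => reflMatrix x l j) =
      2 ^ a * T a x * ((1 / 2) ^ b * R b x) := by
  rw [← Matrix.det_submatrix_equiv_self (interleave ha hb)]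
  have hblock : (Matrix.of fun l j : Fin m => reflMatrix x l j).submatrix
      (interleave ha hb) (interleave ha hb) =
      Matrix.fromBlocks
        ((2 : ℚ) • (Matrix.of fun i j : Fin a =>
          C (x + (i : ℕ) + (j : ℕ)) (2 * (j : ℤ) - (i : ℤ))).transpose) 0 0
        ((1 / 2 : ℚ) • Matrix.of fun i j : Fin b =>
          C (x + (i : ℕ) + (j : ℕ)) (2 * (i : ℤ) - (j : ℤ)) +
            2 * C (x + (i : ℕ) + (j : ℕ) + 2) (2 * (i : ℤ) - (j : ℤ) + 1)) := by
    ext (i | i) (j | j) <;>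
      simp [interleave, reflMatrix_two_mul_two_mul, reflMatrix_two_mul_two_mul_add_one,
        reflMatrix_two_mul_add_one_two_mul, reflMatrix_two_mul_add_one_two_mul_add_one,
        add_right_comm]
  rw [hblock, Matrix.det_fromBlocks_zero₂₁, Matrix.det_smul, Matrix.det_smul,
    Matrix.det_transpose, Fintype.card_fin, Fintype.card_fin]
  rfl

/-- The Mills–Robbins–Rumsey factorization in even size. -/
lemma Z_two_mul (n x : ℕ) : Z (2 * n) (2 * x) = T n x * R n x := by
  rw [Z_eq_det_reflMatrix, det_reflMatrix (a := n) (b := n) (by lia) (by lia)]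
  have : (2 : ℚ) ^ n * (1 / 2) ^ n = 1 := by rw [← mul_pow]; norm_num
  linear_combination (T n x * R n x) * this

/-- The Mills–Robbins–Rumsey factorization in odd size. -/
lemma Z_two_mul_add_one (n x : ℕ) : Z (2 * n + 1) (2 * x) = 2 * T (n + 1) x * R n x := by
  rw [Z_eq_det_reflMatrix, det_reflMatrix (a := n + 1) (b := n) (by lia) (by lia)]
  have : (2 : ℚ) ^ n * (1 / 2) ^ n = 1 := by rw [← mul_pow]; norm_num
  linear_combination (2 * T (n + 1) x * R n x) * this

end Determinant

end CyclicPlanePartitions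

theorem CSTC_product_formula (n x : ℕ) :
    2 ^ n * T n x * ∏ k ∈ Finset.range n, Z (2 * k) (2 * x) =
      ∏ k ∈ Finset.range n, Z (2 * k + 1) (2 * x) := by
  induction n with
  | zero => simp [show T 0 x = 1 from Matrix.det_fin_zero]
  | succ n ih =>
    rw [Finset.prod_range_succ, Finset.prod_range_succ, ← ih,
      CyclicPlanePartitions.Z_two_mul, CyclicPlanePartitions.Z_two_mul_add_one]
    ring
end

section
/- For every nonnegative integer n, det( (1/2)·C(i+j, 2i-j) + C(i+j, 2i-j-1) )_{0≤i,j≤n-1} = 2^{-n} · ( ∏_{i=0}^{n-1} (3i+1)! / (n+i)! )². (Multiplied by 2^n, this determinant is the number CSSC(2n) of cyclically symmetric self-complementary lozenge tilings of the regular hexagon of side 2n.) -/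
open Finset

namespace Matrix

variable {R : Type*} [CommRing R] {n : ℕ}

theorem det_one_add_two_columns (u v : Fin (n + 2) → R) :
    (1 + (of fun i => ![u i, v i] : Matrix (Fin (n + 2)) (Fin 2) R) *
      (of ![Pi.single 0 1, Pi.single (Fin.last (n + 1)) 1] : Matrix (Fin 2) (Fin (n + 2)) R)).det =
      (1 + u 0) * (1 + v (Fin.last _)) - v 0 * u (Fin.last _) := by
  rw [det_one_add_mul_comm, det_fin_two]
  simp

theorem det_of_column_zero (M : Matrix (Fin (n + 1)) (Fin (n + 1)) R)
    (h : ∀ i : Fin n, M i.succ 0 = 0) :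
    M.det = M 0 0 * (M.submatrix Fin.succ Fin.succ).det := by
  rw [det_succ_column_zero, Fin.sum_univ_succ, sum_eq_zero fun i _ => by simp [h]]
  simp

theorem det_of_column_last (M : Matrix (Fin (n + 1)) (Fin (n + 1)) R)
    (h : ∀ i : Fin n, M i.castSucc (Fin.last n) = 0) :
    M.det = M (Fin.last n) (Fin.last n) * (M.submatrix Fin.castSucc Fin.castSucc).det := by
  rw [det_succ_column _ (Fin.last n), Fin.sum_univ_castSucc, sum_eq_zero fun i _ => by simp [h]]
  simp [← two_mul, Fin.succAbove_last]

theorem det_mul_desnanot_jacobi (A : Matrix (Fin (n + 2)) (Fin (n + 2)) R) :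
    A.det * (A.det * (A.submatrix (fun i : Fin n => i.castSucc.succ)
      (fun i : Fin n => i.castSucc.succ)).det) =
    A.det * ((A.submatrix Fin.castSucc Fin.castSucc).det * (A.submatrix Fin.succ Fin.succ).det -
      (A.submatrix Fin.castSucc Fin.succ).det * (A.submatrix Fin.succ Fin.castSucc).det) := by
  let l := Fin.last (n + 1)
  let B : Matrix (Fin (n + 2)) (Fin (n + 2)) R := of fun i j =>
    if j = 0 then A.adjugate i 0 else if j = l then A.adjugate i l else (1 : Matrix _ _ R) i j
  have hl : l ≠ 0 := Fin.last_pos.ne'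
  have hB : B.det = A.adjugate 0 0 * A.adjugate l l - A.adjugate 0 l * A.adjugate l 0 := by
    have := det_one_add_two_columns (fun i => A.adjugate i 0 - (1 : Matrix (Fin (n + 2)) (Fin (n + 2)) R) i 0)
      (fun i => A.adjugate i l - (1 : Matrix (Fin (n + 2)) (Fin (n + 2)) R) i l)
    convert this using 2
    · ext i j
      simp only [B, of_apply, add_apply, mul_apply, Fin.sum_univ_two]
      by_cases h0 : j = 0
      · subst h0; simp [hl.symm, l]
      · by_cases h1 : j = l
        · subst h1; simp [hl, l]
        · simp [h0, show j ≠ Fin.last _ from h1, l]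
    · simp [l]
    · simp [l]
  have hcol (k) (hk : k = 0 ∨ k = l) (i) : (A * B) i k = if i = k then A.det else 0 := by
    have := congrFun (congrFun (mul_adjugate A) i) k
    rw [mul_apply] at this ⊢
    rw [show (if i = k then A.det else 0) = (A.det • (1 : Matrix _ _ R)) i k by
      simp [one_apply], ← this]
    rcases hk with rfl | rfl <;> simp [B, hl]
  have hmid (i) (j : Fin n) : (A * B) i j.castSucc.succ = A i j.castSucc.succ := by
    have hj : j.castSucc.succ ≠ l := by
      rw [Fin.succ_castSucc]
      exact (Fin.castSucc_lt_last _).ne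
    have hBj (k) : B k j.castSucc.succ = (1 : Matrix _ _ R) k j.castSucc.succ := by
      simp only [B, of_apply, Fin.succ_ne_zero, if_neg hj, if_false]
    rw [mul_apply, sum_congr rfl fun k _ => by rw [hBj], ← mul_apply, mul_one]
  have hAB : (A * B).det = A.det * (A.det * (A.submatrix (fun i : Fin n => i.castSucc.succ)
      (fun i : Fin n => i.castSucc.succ)).det) := by
    rw [det_of_column_zero _ fun i => by simp [hcol 0], det_of_column_last _ fun i => ?_]
    · congr 1
      · simp [hcol 0]
      congr 1
      · simp [hcol l, l]
      · congr 1
        ext i j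
        simp [hmid]
    · have := hcol l (.inr rfl) i.castSucc.succ
      simpa [l, Fin.ext_iff, i.2.ne] using this
  rw [← hAB, det_mul, hB]
  simp only [adjugate_fin_succ_eq_det_submatrix, l, Fin.succAbove_zero, Fin.succAbove_last]
  have h1 : (-1 : R) ^ (n + 1) * (-1) ^ (n + 1) = 1 := by rw [← mul_pow]; simp
  have h2 : (-1 : R) ^ (n + 1 + (n + 1)) = 1 := by rw [pow_add, h1]
  simp only [Fin.val_zero, Fin.val_last, add_zero, zero_add, pow_zero, one_mul, h2]
  linear_combination (-A.det * (A.submatrix Fin.castSucc Fin.succ).det *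
    (A.submatrix Fin.succ Fin.castSucc).det) * h1

/-- The Desnanot–Jacobi identity. -/
theorem desnanot_jacobi (A : Matrix (Fin (n + 2)) (Fin (n + 2)) R) :
    A.det * (A.submatrix (fun i : Fin n => i.castSucc.succ)
      (fun i : Fin n => i.castSucc.succ)).det =
    (A.submatrix Fin.castSucc Fin.castSucc).det * (A.submatrix Fin.succ Fin.succ).det -
      (A.submatrix Fin.castSucc Fin.succ).det * (A.submatrix Fin.succ Fin.castSucc).det := by
  let X := mvPolynomialX (Fin (n + 2)) (Fin (n + 2)) ℤ
  have h := mul_left_cancel₀ (det_mvPolynomialX_ne_zero _ ℤ) (det_mul_desnanot_jacobi X)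
  have h' := congrArg (MvPolynomial.aeval fun p : Fin (n + 2) × Fin (n + 2) => A p.1 p.2) h
  have hX : X.map (MvPolynomial.aeval fun p : Fin (n + 2) × Fin (n + 2) => A p.1 p.2) = A :=
    mvPolynomialX_mapMatrix_aeval ℤ A
  simpa only [map_mul, map_sub, AlgHom.map_det, AlgHom.mapMatrix_apply, ← submatrix_map, hX] using h'

end Matrix

open Nat Matrix

/-- The reciprocal of `k!`, zero if `k < 0`. -/
def invFactorial (k : ℤ) : ℚ := if 0 ≤ k then ((k.toNat ! : ℕ) : ℚ)⁻¹ else 0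

theorem invFactorial_natCast (k : ℕ) : invFactorial k = ((k ! : ℕ) : ℚ)⁻¹ := by
  simp [invFactorial]

theorem invFactorial_of_neg {k : ℤ} (h : k < 0) : invFactorial k = 0 := by
  simp [invFactorial, h]

theorem invFactorial_pos {k : ℤ} (h : 0 ≤ k) : 0 < invFactorial k := by
  simp only [invFactorial, if_pos h]
  positivity

theorem invFactorial_sub_one (k : ℤ) : invFactorial (k - 1) = k * invFactorial k := by
  rcases lt_trichotomy k 0 with h | rfl | h
  · rw [invFactorial_of_neg h, invFactorial_of_neg (by lia), mul_zero]
  · simp [invFactorial]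
  · obtain ⟨m, rfl⟩ : ∃ m : ℕ, k = m + 1 := ⟨(k - 1).toNat, by lia⟩
    have h1 := invFactorial_natCast (m + 1)
    push_cast at h1
    rw [add_sub_cancel_right, invFactorial_natCast, h1, factorial_succ]
    push_cast
    field_simp

theorem C_eq_factorial_mul (m : ℕ) (k : ℤ) :
    C m k = (m ! : ℕ) * invFactorial k * invFactorial (m - k) := by
  rcases lt_or_ge k 0 with h | h
  · simp [C, invFactorial_of_neg h, h]
  lift k to ℕ using h
  rcases le_or_gt k m with h | h
  · rw [← Nat.cast_sub h]
    simp only [C, invFactorial_natCast, Nat.cast_nonneg, if_true, Int.toNat_natCast,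
      Nat.cast_choose ℚ h]
    field_simp
  · simp [C, choose_eq_zero_of_lt h, invFactorial_of_neg (show (m : ℤ) - k < 0 by lia)]

/-- The matrix with entries `(x+y+i+j-1)! / ((x+2i-j)! (y+2j-i)!)`, where `s = x+y-1`. -/
def quotMatrix (n s : ℕ) (x y : ℤ) : Matrix (Fin n) (Fin n) ℚ := of fun i j =>
  ((s + i + j) ! : ℕ) * invFactorial (x + 2 * i - j) * invFactorial (y + 2 * j - i)

/-- The quotient of the determinants of `quotMatrix (i + 1) s x y` and `quotMatrix i s x y`. -/
noncomputable def detQuot (s : ℕ) (x y : ℤ) (i : ℕ) : ℚ :=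
  (i ! : ℕ) * ((s + i) ! : ℕ) *
    (ascPochhammer ℚ i).eval (2 * x + y + 2 * i : ℚ) *
    (ascPochhammer ℚ i).eval (x + 2 * y + 2 * i : ℚ) *
    invFactorial (x + 2 * i) * invFactorial (y + 2 * i)

/-- The quotient of the product of the off-diagonal minors in the condensation of
`quotMatrix (k + 2) s x y` by the product of a diagonal and the central minor. -/
noncomputable def crossQuot (s : ℕ) (x y : ℤ) (k : ℕ) : ℚ :=
  (k ! : ℕ) * ((s + k + 1) ! : ℕ) * x * y * (s + 1) *
    (ascPochhammer ℚ k).eval (2 * x + y + 2 * k + 3 : ℚ) *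
    (ascPochhammer ℚ k).eval (x + 2 * y + 2 * k + 3 : ℚ) *
    invFactorial (x + 2 * k + 2) * invFactorial (y + 2 * k + 2)

theorem ascPochhammer_eval_succ_left (k : ℕ) (a : ℚ) :
    (ascPochhammer ℚ (k + 1)).eval a = a * (ascPochhammer ℚ k).eval (a + 1) := by
  simp [ascPochhammer_succ_left]

theorem factorial_mul_ascPochhammer_eval (m k : ℕ) :
    ((m ! : ℕ) : ℚ) * (ascPochhammer ℚ k).eval (m + 1 : ℚ) = ((m + k) ! : ℕ) := by
  induction k with
  | zero => simp
  | succ k ih =>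
    rw [ascPochhammer_succ_eval, ← mul_assoc, ih, ← add_assoc, factorial_succ]
    push_cast
    ring

theorem detQuot_sub_crossQuot (s : ℕ) (x y : ℤ) (h : x + y = s + 1) (k : ℕ) :
    detQuot (s + 2) (x + 1) (y + 1) k - crossQuot s x y k = detQuot s x y (k + 1) := by
  have hs : (s : ℚ) = x + y - 1 := by
    have : (x : ℚ) + y = s + 1 := mod_cast h
    linarith
  have hx := invFactorial_sub_one (x + 2 * k + 2)
  have hy := invFactorial_sub_one (y + 2 * k + 2)
  simp only [detQuot, crossQuot, ascPochhammer_eval_succ_left]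
  rw [show x + 1 + 2 * (k : ℤ) = x + 2 * k + 2 - 1 by ring,
    show y + 1 + 2 * (k : ℤ) = y + 2 * k + 2 - 1 by ring, hx, hy,
    show s + 2 + k = s + k + 1 + 1 by ring, factorial_succ (s + k + 1), factorial_succ k,
    ← add_assoc s k 1]
  push_cast
  rw [show x + 2 * ((k : ℤ) + 1) = x + 2 * k + 2 by ring,
    show y + 2 * ((k : ℤ) + 1) = y + 2 * k + 2 by ring,
    show 2 * (x + 1 : ℚ) + (y + 1) + 2 * k = 2 * x + y + 2 * k + 3 by ring,
    show (x + 1 : ℚ) + 2 * (y + 1) + 2 * k = x + 2 * y + 2 * k + 3 by ring,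
    show 2 * (x : ℚ) + y + 2 * (k + 1) + 1 = 2 * x + y + 2 * k + 3 by ring,
    show (x : ℚ) + 2 * y + 2 * (k + 1) + 1 = x + 2 * y + 2 * k + 3 by ring, hs]
  ring

theorem detQuot_mul_crossQuot (s : ℕ) (x y : ℤ) (k : ℕ) :
    detQuot (s + 1) (x - 1) (y + 2) (k + 1) * detQuot (s + 1) (x + 2) (y - 1) (k + 1) *
      crossQuot s x y k =
    crossQuot s x y (k + 1) * detQuot s x y (k + 1) * detQuot (s + 2) (x + 1) (y + 1) k := by
  simp only [detQuot, crossQuot]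
  push_cast
  ring_nf

theorem prod_detQuot_cross (s : ℕ) (x y : ℤ) (h : x + y = s + 1) (k : ℕ) :
    (∏ i ∈ range (k + 1), detQuot (s + 1) (x - 1) (y + 2) i) *
      (∏ i ∈ range (k + 1), detQuot (s + 1) (x + 2) (y - 1) i) =
    crossQuot s x y k * (∏ i ∈ range (k + 1), detQuot s x y i) *
      ∏ i ∈ range k, detQuot (s + 2) (x + 1) (y + 1) i := by
  induction k with
  | zero =>
    have hs : (x + y : ℚ) = s + 1 := mod_cast h
    have hx := invFactorial_sub_one x
    have hy := invFactorial_sub_one y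
    simp only [detQuot, crossQuot, zero_add, prod_range_one, prod_range_zero, factorial_succ, hx,
      hy, Nat.cast_zero, mul_zero, add_zero, ascPochhammer_zero, Polynomial.eval_one]
    push_cast
    ring
  | succ k ih =>
    rw [prod_range_succ (detQuot (s + 1) (x - 1) (y + 2)) (k + 1),
      prod_range_succ (detQuot (s + 1) (x + 2) (y - 1)) (k + 1),
      prod_range_succ (detQuot s _ _) (k + 1),
      prod_range_succ (detQuot (s + 2) _ _) k, mul_mul_mul_comm, ih]
    linear_combination (∏ i ∈ range (k + 1), detQuot s x y i) *
      (∏ i ∈ range k, detQuot (s + 2) (x + 1) (y + 1) i) * detQuot_mul_crossQuot s x y k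

theorem detQuot_pos (s : ℕ) {x y : ℤ} (hx : 0 ≤ x) (hy : 0 ≤ y) (h : 0 < x + y) (i : ℕ) :
    0 < detQuot s x y i := by
  have hx' : (0 : ℚ) ≤ x := mod_cast hx
  have hy' : (0 : ℚ) ≤ y := mod_cast hy
  have h' : (0 : ℚ) < x + y := mod_cast h
  have h1 := ascPochhammer_pos i (2 * x + y + 2 * i : ℚ) (by linarith [i.cast_nonneg (α := ℚ)])
  have h2 := ascPochhammer_pos i (x + 2 * y + 2 * i : ℚ) (by linarith [i.cast_nonneg (α := ℚ)])
  have h3 := invFactorial_pos (show 0 ≤ x + 2 * i by lia)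
  have h4 := invFactorial_pos (show 0 ≤ y + 2 * i by lia)
  unfold detQuot
  positivity

theorem det_quotMatrix_condensation (n s : ℕ) (x y : ℤ) :
    (quotMatrix (n + 2) s x y).det * (quotMatrix n (s + 2) (x + 1) (y + 1)).det =
      (quotMatrix (n + 1) s x y).det * (quotMatrix (n + 1) (s + 2) (x + 1) (y + 1)).det -
      (quotMatrix (n + 1) (s + 1) (x - 1) (y + 2)).det *
        (quotMatrix (n + 1) (s + 1) (x + 2) (y - 1)).det := by
  have key := desnanot_jacobi (quotMatrix (n + 2) s x y)
  convert key using 4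
  on_goal 2 => rfl
  all_goals
    ext i j
    simp only [quotMatrix, of_apply, submatrix_apply, Fin.val_succ, Fin.val_castSucc]
    push_cast
    exact congrArg₂ (· * ·) (congrArg₂ (· * ·)
      (congrArg (fun m : ℕ => ((m ! : ℕ) : ℚ)) (by ring)) (congrArg _ (by ring)))
      (congrArg _ (by ring))

theorem det_quotMatrix (n s : ℕ) (x y : ℤ) (hx : -1 ≤ x) (hy : -1 ≤ y) (h : x + y = s + 1) :
    (quotMatrix n s x y).det = ∏ i ∈ range n, detQuot s x y i := by
  induction n using Nat.twoStepInduction generalizing s x y with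
  | zero => simp
  | one => simp [quotMatrix, detQuot]
  | more n ih₀ ih₁ =>
    rcases hx.eq_or_lt with rfl | hx
    · rw [det_eq_zero_of_row_eq_zero 0 fun j => by
        simp [quotMatrix, invFactorial_of_neg (show -1 - (j : ℤ) < 0 by lia)]]
      exact (prod_eq_zero (mem_range.2 (Nat.succ_pos _))
        (by simp [detQuot, invFactorial_of_neg])).symm
    rcases hy.eq_or_lt with rfl | hy
    · rw [det_eq_zero_of_column_eq_zero 0 fun j => by
        simp [quotMatrix, invFactorial_of_neg (show -1 - (j : ℤ) < 0 by lia)]]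
      exact (prod_eq_zero (mem_range.2 (Nat.succ_pos _))
        (by simp [detQuot, invFactorial_of_neg])).symm
    have hne : ∏ i ∈ range n, detQuot (s + 2) (x + 1) (y + 1) i ≠ 0 :=
      prod_ne_zero_iff.2 fun i _ => (detQuot_pos _ (by lia) (by lia) (by lia) i).ne'
    have key := det_quotMatrix_condensation n s x y
    rw [ih₀ (s + 2) (x + 1) (y + 1) (by lia) (by lia) (by push_cast; lia),
      ih₁ (s + 2) (x + 1) (y + 1) (by lia) (by lia) (by push_cast; lia),
      ih₁ s x y hx.le hy.le h,
      ih₁ (s + 1) (x - 1) (y + 2) (by lia) (by lia) (by push_cast; lia),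
      ih₁ (s + 1) (x + 2) (y - 1) (by lia) (by lia) (by push_cast; lia),
      prod_detQuot_cross s x y h, prod_range_succ (detQuot (s + 2) _ _) n] at key
    apply mul_right_cancel₀ hne
    rw [key, prod_range_succ _ (n + 1), ← detQuot_sub_crossQuot s x y h]
    ring

theorem half_C_add_C (i j : ℕ) :
    (1 / 2 : ℚ) * C (i + j) (2 * (i : ℤ) - (j : ℤ)) + C (i + j) (2 * (i : ℤ) - (j : ℤ) - 1) =
      (3 * i + 1) / 2 * (((0 + i + j) ! : ℕ) * invFactorial (0 + 2 * i - j) *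
        invFactorial (1 + 2 * j - i)) := by
  have h₁ := invFactorial_sub_one (2 * i - j)
  have h₂ := invFactorial_sub_one (1 + 2 * j - i)
  rw [C_eq_factorial_mul, C_eq_factorial_mul, h₁]
  push_cast at h₂ ⊢
  rw [show (i : ℤ) + j - (2 * i - j) = 1 + 2 * j - i - 1 by ring, h₂,
    show (i : ℤ) + j - (2 * i - j - 1) = 1 + 2 * j - i by ring, zero_add, zero_add]
  ring

theorem detQuot_zero_one (i : ℕ) :
    (3 * i + 1) / 2 * detQuot 0 0 1 i =
      2⁻¹ * (((3 * i + 1) ! : ℕ) * ((i ! : ℕ) / (((2 * i) ! : ℕ) * ((2 * i + 1) ! : ℕ)))) ^ 2 := by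
  have h₁ := factorial_mul_ascPochhammer_eval (2 * i) i
  have h₂ := factorial_mul_ascPochhammer_eval (2 * i + 1) i
  have h₃ := invFactorial_natCast (2 * i)
  have h₄ := invFactorial_natCast (2 * i + 1)
  have h₅ : ((3 * i + 1) ! : ℕ) = ((3 * i + 1 : ℕ) : ℚ) * ((3 * i) ! : ℕ) := by
    rw [factorial_succ]; push_cast; ring
  rw [show 2 * i + i = 3 * i by ring] at h₁
  rw [show 2 * i + 1 + i = 3 * i + 1 by ring] at h₂
  rw [mul_comm, ← eq_div_iff (Nat.cast_ne_zero.2 (factorial_ne_zero _))] at h₁ h₂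
  push_cast at h₁ h₂ h₃ h₄ h₅
  simp only [detQuot]
  push_cast
  rw [show (2 * 0 + 1 + 2 * i : ℚ) = 2 * i + 1 by ring,
    show (0 + 2 * 1 + 2 * i : ℚ) = 2 * i + 1 + 1 by ring, h₁, h₂, zero_add, zero_add,
    add_comm (1 : ℤ), h₃, h₄, h₅]
  field_simp

theorem prod_factorial_div (n : ℕ) :
    ∏ i ∈ range n, ((i ! : ℕ) / (((2 * i) ! : ℕ) * ((2 * i + 1) ! : ℕ)) : ℚ) =
      ∏ i ∈ range n, (((n + i) ! : ℕ) : ℚ)⁻¹ := by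
  induction n with
  | zero => simp
  | succ n ih =>
    have h := (prod_range_succ (fun i => (((n + i) ! : ℕ) : ℚ)⁻¹) n).symm.trans
      (prod_range_succ' (fun i => (((n + i) ! : ℕ) : ℚ)⁻¹) n)
    have h₁ (i : ℕ) : n + 1 + i = n + (i + 1) := by ring
    rw [prod_range_succ, ih, prod_range_succ]
    simp only [h₁]
    rw [← two_mul, add_zero] at h
    rw [← add_assoc, ← two_mul, ← div_mul_cancel₀ (∏ i ∈ range n, (((n + (i + 1)) ! : ℕ) : ℚ)⁻¹)
      (Nat.cast_ne_zero.2 (factorial_ne_zero n)), div_eq_mul_inv _ ((n ! : ℕ) : ℚ), ← h]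
    field_simp

theorem det_A_n1 (n : ℕ) :
    Matrix.det (fun i j : Fin n =>
        (1 / 2 : ℚ) * C ((i : ℕ) + (j : ℕ)) (2 * (i : ℤ) - (j : ℤ)) +
          C ((i : ℕ) + (j : ℕ)) (2 * (i : ℤ) - (j : ℤ) - 1)) =
      ((2 : ℚ) ^ n)⁻¹ *
        (∏ i ∈ Finset.range n,
          (((3 * i + 1).factorial : ℚ) / ((n + i).factorial : ℚ))) ^ 2 := by
  simp only [half_C_add_C]
  refine (det_mul_column (fun i : Fin n => (3 * i + 1 : ℚ) / 2) (quotMatrix n 0 0 1)).trans ?_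
  rw [det_quotMatrix n 0 0 1 (by simp) (by simp) (by simp),
    Fin.prod_univ_eq_prod_range (fun i => (3 * i + 1 : ℚ) / 2), ← prod_mul_distrib]
  simp only [detQuot_zero_one, div_eq_mul_inv (((3 * _ + 1) ! : ℕ) : ℚ)]
  rw [prod_mul_distrib, prod_pow, prod_mul_distrib, prod_mul_distrib, prod_factorial_div]
  simp
end

section
/- Let n be a positive integer and x a nonnegative integer. Then det( C(x+i+j+3, 2i-j+1) + C(x+i+j+2, 2i-j) )_{0≤i,j≤n-2} = det( C(x+i+j+1, 2i-j) + C(x+i+j, 2i-j-1) )_{0≤i,j≤n-1}. (That is, det W_{n-1}(x+2) = det w_n(x) in the notation of Andrews and Stanton, where W_m(y) has (i,j) entry C(y+i+j+1, 2i-j+1) + C(y+i+j, 2i-j).) -/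
open Finset

theorem det_W_eq_det_w (n x : ℕ) (hn : 0 < n) :
    Matrix.det (fun i j : Fin (n - 1) =>
        C (x + (i : ℕ) + (j : ℕ) + 3) (2 * (i : ℤ) - (j : ℤ) + 1) +
          C (x + (i : ℕ) + (j : ℕ) + 2) (2 * (i : ℤ) - (j : ℤ))) =
      Matrix.det (fun i j : Fin n =>
        C (x + (i : ℕ) + (j : ℕ) + 1) (2 * (i : ℤ) - (j : ℤ)) +
          C (x + (i : ℕ) + (j : ℕ)) (2 * (i : ℤ) - (j : ℤ) - 1)) := by
  obtain ⟨m, rfl⟩ := Nat.exists_eq_succ_of_ne_zero hn.ne.symm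
  symm
  -- The first row of the right-hand matrix is `(1, 0, …, 0)`.
  refine (Matrix.det_succ_row_zero (n := m) _).trans ?_
  rw [Fin.sum_univ_succ, Finset.sum_eq_zero]
  · simp only [Fin.val_zero, pow_zero, Matrix.submatrix]
    have corner : C (x + 0 + 0 + 1) (2 * ((0 : ℕ) : ℤ) - ((0 : ℕ) : ℤ)) +
        C (x + 0 + 0) (2 * ((0 : ℕ) : ℤ) - ((0 : ℕ) : ℤ) - 1) = 1 := by
      simp [C]
    rw [corner, one_mul, one_mul, add_zero]
    change Matrix.det (n := Fin m) _ = Matrix.det (n := Fin m) _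
    congr 1
    ext i j
    simp only [Matrix.of_apply, Fin.succAbove_zero, Fin.val_succ]
    congr 2 <;> push_cast <;> ring
  · intro j _
    have hzero (a : ℕ) {k : ℤ} (hk : k < 0) : C a k = 0 := if_neg (not_le.mpr hk)
    rw [hzero _ (by simp; omega), hzero _ (by simp; omega)]
    simp
end
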